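/- Stability of the Gaussian L^p-Poincaré inequality (Theorem 3.10): Let p ≥ 2, n ≥ 2, and let Ω ⊂ ℝⁿ be an open bounded convex set of diameter diam(Ω). Let u₁^γ be a first Gaussian p-Laplacian eigenfunction on Ω (positive in Ω; by the Colesanti–Qin–Salani theorem log u₁^γ is concave). Then for every real-valued smooth function u with compact support in Ω: ∫_Ω |∇u|^p dγ − λ₁(p,Ω,γ) ∫_Ω |u|^p dγ ≥ 2^{2−p} (π_p / diam(Ω))^p · inf_{c∈ℝ} ∫_Ω |u − c·u₁^γ|^p dγ. -/

import Mathlib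

open MeasureTheory Real Filter
open scoped RealInnerProductSpace

/-- `π_p = 2π (p-1)^{1/p} / (p sin(π/p))`. -/
noncomputable def piP (p : ℝ) : ℝ :=
  2 * Real.pi * (p - 1) ^ (1 / p) / (p * Real.sin (Real.pi / p))

/-- The standard Gaussian probability measure `dγ = (2π)^{-n/2} e^{-|x|²/2} dx` on `ℝⁿ`. -/
noncomputable def gaussMeasure (n : ℕ) : Measure (EuclideanSpace ℝ (Fin n)) :=
  volume.withDensity fun x =>
    ENNReal.ofReal ((2 * Real.pi) ^ (-(n : ℝ) / 2) * Real.exp (-‖x‖ ^ 2 / 2))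

/-- The first eigenvalue of the Gaussian `p`-Laplacian on `Ω`, defined as the infimum of the
Gaussian Rayleigh quotients over smooth nontrivial functions compactly supported in `Ω`. -/
noncomputable def lambda1Gauss (n : ℕ) (p : ℝ) (Ω : Set (EuclideanSpace ℝ (Fin n))) : ℝ :=
  sInf { r : ℝ | ∃ u : EuclideanSpace ℝ (Fin n) → ℝ,
    ContDiff ℝ (⊤ : ℕ∞) u ∧ HasCompactSupport u ∧ tsupport u ⊆ Ω ∧ u ≠ 0 ∧
    r = (∫ x in Ω, ‖gradient u x‖ ^ p ∂(gaussMeasure n)) /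
        (∫ x in Ω, |u x| ^ p ∂(gaussMeasure n)) }

/-- The tangent line inequality for `x ↦ x ^ q` on `[0, ∞)`. -/
theorem rpow_tangent_le {x y q : ℝ} (hx : 0 ≤ x) (hy : 0 ≤ y) (hq : 1 ≤ q) :
    y ^ q + q * y ^ (q - 1) * (x - y) ≤ x ^ q := by
  rcases hy.eq_or_lt with rfl | hy
  · rcases hq.eq_or_lt with rfl | hq
    · simp
    · rw [Real.zero_rpow (by linarith), Real.zero_rpow (by linarith)]
      simpa using Real.rpow_nonneg hx q
  · have h := one_add_mul_self_le_rpow_one_add (s := x / y - 1) (p := q)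
      (by have := div_nonneg hx hy.le; linarith) hq
    rw [add_sub_cancel, Real.div_rpow hx hy.le, le_div_iff₀ (Real.rpow_pos_of_pos hy q)] at h
    have e : y ^ q = y ^ (q - 1) * y := by
      rw [← Real.rpow_add_one hy.ne']; simp
    calc y ^ q + q * y ^ (q - 1) * (x - y) = (1 + q * (x / y - 1)) * y ^ q := by
          rw [e]; field_simp
      _ ≤ x ^ q := h

/-- One-dimensional case of the uniform convexity inequality, along opposite directions. -/
theorem rpow_sub_add_ge {p α β : ℝ} (hp : 2 ≤ p) (hα : 0 ≤ α) (hβ : 2 * α ≤ β) :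
    2 ^ (2 - p) * β ^ p ≤ (β - α) ^ p - α ^ p + p * α ^ (p - 1) * β := by
  have hd : ∀ x ∈ Set.Ioi (2 * α), HasDerivAt
      (fun x => (x - α) ^ p - α ^ p + p * α ^ (p - 1) * x - 2 ^ (2 - p) * x ^ p)
      (p * ((x - α) ^ (p - 1) + α ^ (p - 1) - 2 ^ (2 - p) * x ^ (p - 1))) x := by
    intro x _
    have h1 := ((hasDerivAt_id x).sub_const α).rpow_const (p := p) (Or.inr (by linarith))
    have h2 := ((hasDerivAt_id x).const_mul (p * α ^ (p - 1)))
    have h3 := ((hasDerivAt_id x).rpow_const (p := p) (Or.inr (by linarith))).const_mul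
      ((2 : ℝ) ^ (2 - p))
    refine (((h1.sub_const (α ^ p)).add h2).sub h3).congr_deriv ?_
    simp only [id]; ring
  have hmono : MonotoneOn
      (fun x => (x - α) ^ p - α ^ p + p * α ^ (p - 1) * x - 2 ^ (2 - p) * x ^ p)
      (Set.Ici (2 * α)) := by
    apply monotoneOn_of_deriv_nonneg (convex_Ici _)
    · have h0 : (0:ℝ) ≤ p := by linarith
      apply Continuous.continuousOn
      fun_prop (disch := exact h0)
    · intro x hx
      rw [interior_Ici] at hx
      exact (hd x hx).differentiableAt.differentiableWithinAt
    · intro x hx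
      rw [interior_Ici] at hx
      rw [(hd x hx).deriv]
      have hx' : 2 * α < x := hx
      have hxα : 0 ≤ x - α := by linarith
      have h2α : 0 ≤ x / 2 := by linarith
      have t1 := rpow_tangent_le hxα h2α (by linarith : 1 ≤ p - 1)
      have t2 := rpow_tangent_le hα h2α (by linarith : 1 ≤ p - 1)
      have t3 : (2:ℝ) ^ (2 - p) * x ^ (p - 1) = 2 * (x / 2) ^ (p - 1) := by
        rw [Real.div_rpow (by linarith) (by norm_num), show 2 - p = 1 - (p - 1) by ring,
          Real.rpow_sub (by norm_num)]
        simp; ring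
      rw [t3]
      apply mul_nonneg (by linarith)
      nlinarith
  have h := hmono (Set.self_mem_Ici) hβ hβ
  simp only at h
  have e1 : 2 * α - α = α := by ring
  have e2 : α ^ (p - 1) * α = α ^ p := by
    rcases hα.eq_or_lt with rfl | hα
    · rw [Real.zero_rpow (by linarith : p ≠ 0)]; simp
    · rw [← Real.rpow_add_one hα.ne']; simp
  have e3 : (2:ℝ) ^ (2 - p) * (2 * α) ^ p = 4 * α ^ p := by
    rw [Real.mul_rpow (by norm_num) hα, ← mul_assoc, ← Real.rpow_add (by norm_num)]
    norm_num
  rw [e1, e3] at h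
  have e4 : p * α ^ (p - 1) * (2 * α) = 2 * p * α ^ p := by rw [← e2]; ring
  rw [e4] at h
  have := Real.rpow_nonneg hα p
  nlinarith

theorem norm_add_rpow_ge {E : Type*} [NormedAddCommGroup E] [InnerProductSpace ℝ E]
    {p : ℝ} (hp : 2 ≤ p) (a b : E) :
    ‖a‖ ^ p + p * (‖a‖ ^ (p - 2) * ⟪a, b⟫) + 2 ^ (2 - p) * ‖b‖ ^ p ≤ ‖a + b‖ ^ p := by
  have hsq : ‖a + b‖ ^ 2 = ‖a‖ ^ 2 + 2 * ⟪a, b⟫ + ‖b‖ ^ 2 := norm_add_sq_real a b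
  have htri : |‖b‖ - ‖a‖| ≤ ‖a + b‖ := by
    simpa [add_comm] using abs_norm_sub_norm_le b (-a)
  generalize ⟪a, b⟫ = c at *
  have hα := norm_nonneg a
  have hβ := norm_nonneg b
  have hX := norm_nonneg (a + b)
  generalize ‖a + b‖ = x at *
  generalize ‖a‖ = α at *
  generalize ‖b‖ = β at *
  have hpow : ∀ y : ℝ, 0 ≤ y → (y ^ 2) ^ (p / 2) = y ^ p := by
    intro y hy
    rw [← Real.rpow_natCast, ← Real.rpow_mul hy]; congr 1; push_cast; ring
  have hpow' : ∀ y : ℝ, 0 ≤ y → (y ^ 2) ^ (p / 2 - 1) = y ^ (p - 2) := by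
    intro y hy
    rw [← Real.rpow_natCast, ← Real.rpow_mul hy]; congr 1; push_cast; ring
  have hp2 : ∀ y : ℝ, 0 ≤ y → y ^ p = y ^ (p - 2) * y ^ 2 := by
    intro y hy
    rcases hy.eq_or_lt with rfl | hy
    · rw [Real.zero_rpow (by linarith)]; simp
    · rw [← Real.rpow_natCast, ← Real.rpow_add hy]; congr 1; push_cast; ring
  have hc : c = (x ^ 2 - α ^ 2 - β ^ 2) / 2 := by linarith
  rcases le_total β (2 * α) with h | h
  · have ht := rpow_tangent_le (sq_nonneg x) (sq_nonneg α) (by linarith : 1 ≤ p / 2)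
    rw [hpow _ hX, hpow _ hα, hpow' _ hα] at ht
    have h1 : 2 ^ (2 - p) * β ^ p ≤ α ^ (p - 2) * β ^ 2 := by
      rw [hp2 β hβ, ← mul_assoc]
      gcongr
      have : (2:ℝ) ^ (2 - p) * β ^ (p - 2) = (β / 2) ^ (p - 2) := by
        rw [Real.div_rpow hβ (by norm_num), show 2 - p = -(p - 2) by ring,
          Real.rpow_neg (by norm_num)]
        field_simp
      rw [this]
      exact Real.rpow_le_rpow (by linarith) (by linarith) (by linarith)
    have h2 : 0 ≤ α ^ (p - 2) * β ^ 2 := by positivity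
    rw [hc]
    nlinarith
  · have hx0 : 0 ≤ β - α := by linarith
    have hle : β - α ≤ x := (le_abs_self _).trans htri
    have ht := rpow_tangent_le (sq_nonneg x) (sq_nonneg (β - α)) (by linarith : 1 ≤ p / 2)
    rw [hpow _ hX, hpow _ hx0, hpow' _ hx0] at ht
    have h1 : α ^ (p - 2) ≤ (β - α) ^ (p - 2) :=
      Real.rpow_le_rpow hα (by linarith) (by linarith)
    have h2 : (β - α) ^ 2 ≤ x ^ 2 := by gcongr
    have h3 := rpow_sub_add_ge hp hα h
    have e2 : α ^ (p - 1) = α ^ (p - 2) * α := by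
      rcases hα.eq_or_lt with rfl | hα
      · rw [Real.zero_rpow (by linarith)]; simp
      · rw [← Real.rpow_add_one hα.ne']; congr 1; ring
    have h4 := mul_le_mul_of_nonneg_right h1 (sub_nonneg.2 h2)
    rw [e2] at h3
    have e3 := hp2 α hα
    rw [hc]
    nlinarith

theorem abs_sub_rpow_ge {p : ℝ} (hp : 2 ≤ p) (v k : ℝ) :
    |v| ^ p - p * k * (|v| ^ (p - 2) * v) ≤ |v - k| ^ p := by
  have h := norm_add_rpow_ge hp v (-k)
  simp only [Real.norm_eq_abs, RCLike.inner_apply, conj_trivial,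
    abs_neg, ← sub_eq_add_neg] at h
  have : 0 ≤ (2:ℝ) ^ (2 - p) * |k| ^ p := by positivity
  linarith

theorem young_riccati {p v z φ : ℝ} (hp : 2 ≤ p) (hv : 0 ≤ v) (hz : 0 ≤ z) (hφ : 0 ≤ φ) :
    p * (v ^ (p - 1) * z * φ) ≤ z ^ p + (p - 1) * (v ^ p * φ ^ (p / (p - 1))) := by
  have hpq : p.HolderConjugate (p / (p - 1)) := Real.HolderConjugate.conjExponent (by linarith)
  have h := Real.young_inequality_of_nonneg hz
    (mul_nonneg (Real.rpow_nonneg hv (p - 1)) hφ) hpq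
  have h1 : p - 1 ≠ 0 := by linarith
  rw [Real.mul_rpow (Real.rpow_nonneg hv _) hφ, ← Real.rpow_mul hv,
    show (p - 1) * (p / (p - 1)) = p by field_simp] at h
  have h2 := mul_le_mul_of_nonneg_left h (by linarith : 0 ≤ p)
  have h0 : p ≠ 0 := by linarith
  calc p * (v ^ (p - 1) * z * φ) = p * (z * (v ^ (p - 1) * φ)) := by ring
    _ ≤ _ := h2
    _ = _ := by field_simp

theorem lintegral_inv_add_mul_rpow {κ c q : ℝ} (hκ : 0 < κ) (hc : 0 < c) (hq : 1 < q) :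
    ∫⁻ x in Set.Ioi (0:ℝ), ENNReal.ofReal ((κ + c * x ^ q)⁻¹) =
      ENNReal.ofReal (c ^ (-1 / q) * κ ^ (-(1 - 1 / q)) * (1 / q) *
        (π / Real.sin (π * (1 / q)))) := by
  have hq0 : 0 < q := by linarith
  have hq1 : 1 / q < 1 := by rw [div_lt_one hq0]; exact hq
  have e1 : ∀ x ∈ Set.Ioi (0:ℝ), ENNReal.ofReal ((κ + c * x ^ q)⁻¹) =
      ∫⁻ t in Set.Ioi (0:ℝ), ENNReal.ofReal (Real.exp (-(κ + c * x ^ q) * t)) := by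
    intro x hx
    have hA : 0 < κ + c * x ^ q := by
      have : 0 ≤ x ^ q := Real.rpow_nonneg (le_of_lt hx) q
      positivity
    rw [← ofReal_integral_eq_lintegral_ofReal
      (integrableOn_exp_mul_Ioi (by linarith) 0) (ae_of_all _ fun t => (Real.exp_pos _).le),
      integral_exp_mul_Ioi (by linarith) 0]
    congr 1
    rw [mul_zero, Real.exp_zero, neg_div_neg_eq, one_div]
  rw [setLIntegral_congr_fun measurableSet_Ioi e1, lintegral_lintegral_swap (by fun_prop)]
  have e2 : ∀ t ∈ Set.Ioi (0:ℝ),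
      ∫⁻ x in Set.Ioi (0:ℝ), ENNReal.ofReal (Real.exp (-(κ + c * x ^ q) * t)) =
      ENNReal.ofReal (c ^ (-1 / q) * Real.Gamma (1 / q + 1) *
        (t ^ ((1 - 1 / q) - 1) * Real.exp (-(κ * t)))) := by
    intro t ht
    have ht0 : 0 < t := ht
    have hct : 0 < c * t := by positivity
    have hsplit : ∀ x : ℝ, Real.exp (-(κ + c * x ^ q) * t) =
        Real.exp (-(κ * t)) * Real.exp (-(c * t) * x ^ q) := by
      intro x; rw [← Real.exp_add]; congr 1; ring
    have hi := integrableOn_rpow_mul_exp_neg_mul_rpow (s := 0) (by norm_num) hq0 hct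
    simp only [Real.rpow_zero, one_mul] at hi
    simp_rw [hsplit]
    rw [← ofReal_integral_eq_lintegral_ofReal (hi.const_mul _)
      (ae_of_all _ fun x => by positivity), integral_const_mul,
      integral_exp_neg_mul_rpow hq0 hct, Real.mul_rpow hc.le ht0.le]
    congr 1
    rw [show (1 - 1 / q) - 1 = -1 / q by ring]
    ring
  rw [setLIntegral_congr_fun measurableSet_Ioi e2]
  have hi2 : IntegrableOn (fun t : ℝ => t ^ ((1 - 1 / q) - 1) * Real.exp (-(κ * t)))
      (Set.Ioi 0) := by
    have := integrableOn_rpow_mul_exp_neg_mul_rpow (s := (1 - 1 / q) - 1) (p := 1)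
      (by linarith) one_pos hκ
    simpa using this
  have hG : 0 ≤ Real.Gamma (1 / q + 1) := (Real.Gamma_pos_of_pos (by positivity)).le
  rw [← ofReal_integral_eq_lintegral_ofReal (hi2.const_mul _)
    ((ae_restrict_mem measurableSet_Ioi).mono fun t ht => by
      have : 0 < t := ht
      simp only [Pi.zero_apply]; positivity), integral_const_mul,
    Real.integral_rpow_mul_exp_neg_mul_Ioi (by linarith) hκ]
  congr 1
  rw [Real.Gamma_add_one (by positivity), ← Real.Gamma_mul_Gamma_one_sub, one_div κ,
    Real.inv_rpow hκ.le, Real.rpow_neg hκ.le]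
  ring

/-- The `p`-trigonometric quarter period is asymptotically reached: this is where `π_p` enters. -/
theorem exists_lt_two_mul_integral {p κ d : ℝ} (hp : 2 ≤ p) (hd : 0 < d) (hκ : 0 < κ)
    (hκd : κ < (2 * π * (p - 1) ^ (1 / p) / (p * Real.sin (π / p)) / d) ^ p) (Y₀ : ℝ) :
    ∃ Y, Y₀ ≤ Y ∧ 0 < Y ∧
      d < 2 * ∫ y in (0:ℝ)..Y, (κ + (p - 1) * y ^ (p / (p - 1)))⁻¹ := by
  set q := p / (p - 1) with hqdef
  have hp1 : 0 < p - 1 := by linarith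
  have hp0 : 0 < p := by linarith
  have hq : 1 < q := by rw [hqdef, lt_div_iff₀ hp1]; linarith
  have hq' : 1 / q = 1 - 1 / p := by rw [hqdef]; field_simp
  have hsin : 0 < Real.sin (π / p) := by
    apply Real.sin_pos_of_pos_of_lt_pi (by positivity)
    exact div_lt_self Real.pi_pos (by linarith)
  have hl := lintegral_inv_add_mul_rpow hκ hp1 hq
  have hsin' : Real.sin (π * (1 / q)) = Real.sin (π / p) := by
    rw [hq', ← Real.sin_pi_sub]; congr 1; ring
  rw [hsin'] at hl
  have hmeas : AEStronglyMeasurable (fun x : ℝ => (κ + (p - 1) * x ^ q)⁻¹)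
      (volume.restrict (Set.Ioi 0)) := by
    apply Measurable.aestronglyMeasurable; fun_prop
  have hnn : 0 ≤ᵐ[volume.restrict (Set.Ioi 0)] fun x : ℝ => (κ + (p - 1) * x ^ q)⁻¹ :=
    (ae_restrict_mem measurableSet_Ioi).mono fun t ht => by
      have : 0 < t := ht
      simp only [Pi.zero_apply]; positivity
  have hint : IntegrableOn (fun x : ℝ => (κ + (p - 1) * x ^ q)⁻¹) (Set.Ioi 0) := by
    refine ⟨hmeas, ?_⟩
    rw [hasFiniteIntegral_iff_ofReal hnn, hl]
    exact ENNReal.ofReal_lt_top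
  have hval : ∫ x in Set.Ioi (0:ℝ), (κ + (p - 1) * x ^ q)⁻¹ =
      (p - 1) ^ (-1 / q) * κ ^ (-(1 - 1 / q)) * (1 / q) * (π / Real.sin (π / p)) := by
    rw [integral_eq_lintegral_of_nonneg_ae hnn hmeas, hl, ENNReal.toReal_ofReal]
    positivity
  have hlt : d < 2 * ∫ x in Set.Ioi (0:ℝ), (κ + (p - 1) * x ^ q)⁻¹ := by
    rw [hval]
    have h1 : κ ^ (1 / p) < 2 * π * (p - 1) ^ (1 / p) / (p * Real.sin (π / p)) / d := by
      have := Real.rpow_lt_rpow hκ.le hκd (by positivity : 0 < 1 / p)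
      rwa [← Real.rpow_mul (by positivity), mul_one_div_cancel hp0.ne', Real.rpow_one] at this
    have h2 : (0:ℝ) < κ ^ (1 / p) := by positivity
    rw [lt_div_iff₀ hd] at h1
    have e1 : -(1 - 1 / q) = -(1 / p) := by rw [hq']; ring
    have e2 : -1 / q = 1 / p - 1 := by rw [neg_div, hq']; ring
    rw [e1, e2, Real.rpow_neg hκ.le, Real.rpow_sub hp1, Real.rpow_one, hq']
    have e3 : 2 * ((p - 1) ^ (1 / p) / (p - 1) * (κ ^ (1 / p))⁻¹ * (1 - 1 / p) *
        (π / Real.sin (π / p))) =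
        (2 * π * (p - 1) ^ (1 / p) / (p * Real.sin (π / p))) / κ ^ (1 / p) := by
      field_simp
    rw [e3, lt_div_iff₀ h2]
    linarith
  have ht := (intervalIntegral_tendsto_integral_Ioi 0 hint tendsto_id).const_mul 2
  obtain ⟨Y, h1, h2, h3⟩ := ((ht.eventually (lt_mem_nhds hlt)).and
    ((eventually_ge_atTop Y₀).and (eventually_gt_atTop 0))).exists
  exact ⟨Y, h2, h3, h1⟩

/-- The truncated right-hand side of the Riccati equation
`-φ' = κ + m φ + (p - 1) φ ^ (p / (p - 1))`. -/
noncomputable def riccatiRhs (p κ m y : ℝ) : ℝ :=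
  max (κ / 2) (κ + m * y + (p - 1) * |y| ^ (p / (p - 1)))

/-- The time needed by the truncated Riccati flow to descend from `Y` to `0`. -/
noncomputable def riccatiTime (p κ Y m : ℝ) : ℝ := ∫ y in (0:ℝ)..Y, (riccatiRhs p κ m y)⁻¹

theorem riccatiRhs_pos {p κ : ℝ} (hκ : 0 < κ) (m y : ℝ) : 0 < riccatiRhs p κ m y :=
  lt_max_of_lt_left (by positivity)

theorem continuous_riccatiRhs {p : ℝ} (hp : 2 ≤ p) (κ : ℝ) :
    Continuous fun z : ℝ × ℝ => riccatiRhs p κ z.1 z.2 := by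
  have : 0 ≤ p / (p - 1) := div_nonneg (by linarith) (by linarith)
  unfold riccatiRhs
  fun_prop (disch := exact this)

theorem continuous_riccatiTime {p κ : ℝ} (hp : 2 ≤ p) (hκ : 0 < κ) (Y : ℝ) :
    Continuous (riccatiTime p κ Y) := by
  apply intervalIntegral.continuous_parametric_intervalIntegral_of_continuous'
  exact (continuous_riccatiRhs hp κ).inv₀ fun z => (riccatiRhs_pos hκ _ _).ne'

theorem intervalIntegrable_riccatiRhs_inv {p κ : ℝ} (hp : 2 ≤ p) (hκ : 0 < κ) (m a b : ℝ) :
    IntervalIntegrable (fun y => (riccatiRhs p κ m y)⁻¹) volume a b := by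
  apply Continuous.intervalIntegrable
  exact (((continuous_riccatiRhs hp κ).comp (by fun_prop : Continuous fun y : ℝ => (m, y)))).inv₀
    fun z => (riccatiRhs_pos hκ _ _).ne'

theorem antitone_riccatiTime {p κ Y : ℝ} (hp : 2 ≤ p) (hκ : 0 < κ) (hY : 0 ≤ Y) :
    Antitone (riccatiTime p κ Y) := by
  intro m m' h
  apply intervalIntegral.integral_mono_on hY (intervalIntegrable_riccatiRhs_inv hp hκ _ _ _)
    (intervalIntegrable_riccatiRhs_inv hp hκ _ _ _)
  intro y hy
  apply inv_anti₀ (riccatiRhs_pos hκ _ _)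
  unfold riccatiRhs
  have := hy.1
  gcongr

theorem inv_max_add_inv_max_ge {A e x : ℝ} (he : 0 < e) (hA : 2 * e ≤ A) :
    2 * A⁻¹ ≤ (max e (A + x))⁻¹ + (max e (A - x))⁻¹ := by
  wlog hx : 0 ≤ x generalizing x
  · have := this (x := -x) (by linarith)
    simpa [add_comm, sub_eq_add_neg] using this
  have hA0 : 0 < A := by linarith
  rw [max_eq_right (by linarith : e ≤ A + x)]
  rcases le_total (A - x) e with h | h
  · rw [max_eq_left h]
    have h1 : 2 * A⁻¹ ≤ e⁻¹ := by
      rw [← div_eq_mul_inv, inv_eq_one_div, div_le_div_iff₀ hA0 he]; linarith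
    have : 0 ≤ (A + x)⁻¹ := by positivity
    linarith
  · rw [max_eq_right h]
    have h1 : 0 < A - x := by linarith
    have h2 : 0 < A + x := by linarith
    rw [← sub_nonneg]
    have : (A + x)⁻¹ + (A - x)⁻¹ - 2 * A⁻¹ = 2 * x ^ 2 / ((A + x) * (A - x) * A) := by
      field_simp; ring
    rw [this]; positivity

theorem riccatiTime_add_ge {p κ Y : ℝ} (hp : 2 ≤ p) (hκ : 0 < κ) (hY : 0 ≤ Y) (m : ℝ) :
    2 * ∫ y in (0:ℝ)..Y, (κ + (p - 1) * y ^ (p / (p - 1)))⁻¹ ≤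
      riccatiTime p κ Y m + riccatiTime p κ Y (-m) := by
  have hq : 0 ≤ p / (p - 1) := div_nonneg (by linarith) (by linarith)
  have hp1 : 0 ≤ p - 1 := by linarith
  unfold riccatiTime
  rw [← intervalIntegral.integral_add (intervalIntegrable_riccatiRhs_inv hp hκ _ _ _)
    (intervalIntegrable_riccatiRhs_inv hp hκ _ _ _), ← intervalIntegral.integral_const_mul]
  apply intervalIntegral.integral_mono_on hY
  · apply ContinuousOn.intervalIntegrable
    apply ContinuousOn.const_mul
    apply ContinuousOn.inv₀ (by fun_prop (disch := exact hq))
    intro y hy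
    rw [Set.uIcc_of_le hY] at hy
    have := Real.rpow_nonneg hy.1 (p / (p - 1))
    positivity
  · exact (intervalIntegrable_riccatiRhs_inv hp hκ _ _ _).add
      (intervalIntegrable_riccatiRhs_inv hp hκ _ _ _)
  · intro y hy
    have h0 := Real.rpow_nonneg hy.1 (p / (p - 1))
    have := inv_max_add_inv_max_ge (A := κ + (p - 1) * y ^ (p / (p - 1))) (e := κ / 2)
      (x := m * y) (by positivity) (by nlinarith [mul_nonneg hp1 h0])
    unfold riccatiRhs
    rw [abs_of_nonneg hy.1]
    convert this using 4 <;> ring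

theorem exists_le_riccatiTime_neg {p κ Y d : ℝ} (hp : 2 ≤ p) (hκ : 0 < κ) (hY : 0 < Y)
    (hYd : κ * d ≤ Y) : ∃ M, 0 < M ∧ d ≤ riccatiTime p κ Y (-M) := by
  have hq : 0 ≤ p / (p - 1) := div_nonneg (by linarith) (by linarith)
  have hp1 : 0 ≤ p - 1 := by linarith
  have hYq := Real.rpow_nonneg hY.le (p / (p - 1))
  refine ⟨(κ + (p - 1) * Y ^ (p / (p - 1))) * (2 / Y), by positivity, ?_⟩
  have h0 : ∀ m y, 0 ≤ (riccatiRhs p κ m y)⁻¹ := fun m y => (inv_pos.2 (riccatiRhs_pos hκ m y)).le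
  calc d ≤ ∫ y in (Y / 2)..Y, (κ / 2)⁻¹ := by
        rw [intervalIntegral.integral_const, smul_eq_mul]
        field_simp
        linarith
    _ ≤ ∫ y in (Y / 2)..Y,
        (riccatiRhs p κ (-((κ + (p - 1) * Y ^ (p / (p - 1))) * (2 / Y))) y)⁻¹ := by
        apply intervalIntegral.integral_mono_on (by linarith) (by simp)
          (intervalIntegrable_riccatiRhs_inv hp hκ _ _ _)
        intro y hy
        rw [riccatiRhs, max_eq_left]
        have hy0 : 0 ≤ y := by linarith [hy.1]
        have h1 : y ^ (p / (p - 1)) ≤ Y ^ (p / (p - 1)) := Real.rpow_le_rpow hy0 hy.2 hq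
        have h2 : 1 ≤ 2 / Y * y := by
          have := hy.1
          rw [div_mul_eq_mul_div, le_div_iff₀ hY]; linarith
        have h3 : 0 ≤ κ + (p - 1) * Y ^ (p / (p - 1)) := by positivity
        rw [abs_of_nonneg hy0]
        nlinarith [mul_le_mul_of_nonneg_left h2 h3, mul_le_mul_of_nonneg_left h1 hp1]
    _ ≤ _ := by
        apply intervalIntegral.integral_mono_interval (by linarith) (by linarith) le_rfl
        · exact ae_of_all _ fun y => h0 _ y
        · exact intervalIntegrable_riccatiRhs_inv hp hκ _ _ _

/-- A concave function lies below the tangent line of `Φ` at a maximum of `η - Φ`. -/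
theorem ConcaveOn.le_tangent_of_isMaxOn {s : Set ℝ} {η Φ : ℝ → ℝ} {c m t : ℝ}
    (hη : ConcaveOn ℝ s η) (hΦ : HasDerivAt Φ m c) (hc : c ∈ s) (ht : t ∈ s)
    (hmax : ∀ x ∈ s, η x - Φ x ≤ η c - Φ c) : η t ≤ η c + m * (t - c) := by
  have hψ : HasDerivAt (fun τ : ℝ => Φ (c + τ * (t - c))) (m * (t - c)) 0 := by
    have h1 : HasDerivAt (fun τ : ℝ => c + τ * (t - c)) (t - c) 0 := by
      simpa using ((hasDerivAt_id (0:ℝ)).mul_const (t - c)).const_add c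
    have h2 : HasDerivAt Φ m (c + 0 * (t - c)) := by simpa using hΦ
    exact h2.comp (0:ℝ) h1
  have hlim := hψ.tendsto_slope_zero_right
  have : η t - η c ≤ m * (t - c) := by
    refine ge_of_tendsto hlim ?_
    have : Set.Ioc (0:ℝ) 1 ∈ nhdsWithin (0:ℝ) (Set.Ioi 0) := Ioc_mem_nhdsGT one_pos
    filter_upwards [this] with τ hτ
    have hcc := hη.2 hc ht (by linarith [hτ.2] : (0:ℝ) ≤ 1 - τ) hτ.1.le (by ring)
    have hmem := hη.1 hc ht (by linarith [hτ.2] : (0:ℝ) ≤ 1 - τ) hτ.1.le (by ring)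
    have hm := hmax _ hmem
    have e : (1 - τ) • c + τ • t = c + τ * (t - c) := by simp only [smul_eq_mul]; ring
    rw [e] at hcc hm
    simp only [smul_eq_mul] at hcc
    simp only [zero_add, zero_mul, add_zero, smul_eq_mul]
    rw [← div_eq_inv_mul, le_div_iff₀ hτ.1]
    nlinarith
  linarith

theorem exists_balanced_point {T η : ℝ → ℝ} (hTc : Continuous T) (hTa : Antitone T)
    {a b σ M : ℝ} (hab : a ≤ b) (hσ : 0 < σ) (hsum : ∀ m, b - a + σ ≤ T m + T (-m))
    (hM : 0 < M) (hTM : b - a ≤ T (-M))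
    (hη : ConcaveOn ℝ (Set.Icc a b) η) (hηc : ContinuousOn η (Set.Icc a b)) :
    ∃ c ∈ Set.Icc a b, ∃ m, b - c ≤ T m ∧ c - a ≤ T (-m) ∧
      AntitoneOn (fun t => η t - m * t) (Set.Icc c b) ∧
      MonotoneOn (fun t => η t - m * t) (Set.Icc a c) := by
  set s := σ / (2 * M) with hs
  have hs0 : 0 < s := by positivity
  have hsM : 2 * (s * M) = σ := by rw [hs]; field_simp
  let ℓ : ℝ → ℝ := fun m => (a + b + T (-m) - T m) / 2 + s * m
  have hℓmono : StrictMono ℓ := by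
    intro m m' h
    have h1 := hTa h.le
    have h2 := hTa (neg_le_neg h.le)
    have h3 := mul_lt_mul_of_pos_left h hs0
    simp only [ℓ]; linarith
  have hℓcont : Continuous ℓ := by fun_prop
  have hℓsurj : Function.Surjective ℓ := by
    apply hℓcont.surjective
    · refine tendsto_atTop_mono' _ ?_ ((tendsto_id.const_mul_atTop hs0).atTop_add
        (tendsto_const_nhds (x := (a + b) / 2)))
      filter_upwards [eventually_ge_atTop 0] with m hm
      have := hTa (by linarith : -m ≤ m)
      simp only [ℓ, id]; linarith
    · refine tendsto_atBot_mono' _ ?_ ((tendsto_id.const_mul_atBot hs0).atBot_add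
        (tendsto_const_nhds (x := (a + b) / 2)))
      filter_upwards [eventually_le_atBot 0] with m hm
      have := hTa (by linarith : m ≤ -m)
      simp only [ℓ, id]; linarith
  let e := StrictMono.orderIsoOfSurjective ℓ hℓmono hℓsurj
  have hμc : Continuous e.symm := e.symm.continuous
  have hℓμ : ∀ t, ℓ (e.symm t) = t := fun t => e.apply_symm_apply t
  let Φ : ℝ → ℝ := fun t => ∫ x in a..t, e.symm x
  have hΦ : ∀ t, HasDerivAt Φ (e.symm t) t := fun t =>
    intervalIntegral.integral_hasDerivAt_right (hμc.intervalIntegrable _ _)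
      (hμc.stronglyMeasurableAtFilter _ _) hμc.continuousAt
  obtain ⟨c, hc, hmax⟩ := isCompact_Icc.exists_isMaxOn (Set.nonempty_Icc.2 hab)
    (hηc.sub (fun t _ => (hΦ t).continuousAt.continuousWithinAt : ContinuousOn Φ _))
  have htan : ∀ t ∈ Set.Icc a b, η t ≤ η c + e.symm c * (t - c) := fun t ht =>
    hη.le_tangent_of_isMaxOn (hΦ c) hc ht fun x hx => hmax hx
  have hℓc := hℓμ c
  generalize e.symm c = m at *
  have hconc : ConcaveOn ℝ (Set.Icc a b) (fun t => η t - m * t) := by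
    refine hη.sub ?_
    exact ((LinearMap.mul ℝ ℝ m).convexOn (convex_Icc a b))
  simp only [ℓ] at hℓc
  refine ⟨c, hc, m, ?_, ?_, ?_, ?_⟩
  · rcases le_total (-M) m with h | h
    · have := hsum m
      nlinarith
    · have := hTa h
      linarith [hc.1]
  · rcases le_total m M with h | h
    · have := hsum m
      nlinarith
    · have := hTa (neg_le_neg h)
      linarith [hc.2]
  · intro x hx y hy hxy
    have h := hconc.min_le_of_mem_Icc hc ⟨hc.1.trans hy.1, hy.2⟩ ⟨hx.1, hxy⟩
    have h2 := htan y ⟨hc.1.trans hy.1, hy.2⟩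
    rwa [min_eq_right (by linarith)] at h
  · intro x hx y hy hxy
    have h := hconc.min_le_of_mem_Icc ⟨hx.1, hx.2.trans hc.2⟩ hc ⟨hxy, hy.2⟩
    have h2 := htan x ⟨hx.1, hx.2.trans hc.2⟩
    rwa [min_eq_left (by linarith)] at h

theorem exists_riccati_supersolution {p κ Y m : ℝ} (hp : 2 ≤ p) (hκ : 0 < κ) (hY : 0 ≤ Y) :
    ∃ φ : ℝ → ℝ, ∀ x ∈ Set.Icc 0 (riccatiTime p κ Y m),
      0 ≤ φ x ∧ HasDerivAt φ (-riccatiRhs p κ m (φ x)) x := by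
  let R : ℝ → ℝ := fun y => riccatiRhs p κ m (max 0 (min y Y))
  have hRc : Continuous R :=
    (continuous_riccatiRhs hp κ).comp (by fun_prop : Continuous fun y : ℝ => (m, max 0 (min y Y)))
  have hR0 : ∀ y, 0 < R y := fun y => riccatiRhs_pos hκ _ _
  have hRi : Continuous fun y => (R y)⁻¹ := hRc.inv₀ fun y => (hR0 y).ne'
  obtain ⟨B, hB⟩ : ∃ B, ∀ y, R y ≤ B := by
    have hc2 : Continuous fun y : ℝ => riccatiRhs p κ m y :=
      (continuous_riccatiRhs hp κ).comp (by fun_prop : Continuous fun y : ℝ => (m, y))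
    obtain ⟨B, hB⟩ := (isCompact_Icc (a := (0:ℝ)) (b := Y)).bddAbove_image hc2.continuousOn
    exact ⟨B, fun y => hB ⟨_, ⟨le_max_left _ _, max_le hY (min_le_right _ _)⟩, rfl⟩⟩
  have hBpos : 0 < B := (hR0 0).trans_le (hB 0)
  let F : ℝ → ℝ := fun y => ∫ x in (0:ℝ)..y, (R x)⁻¹
  have hF : ∀ y, HasDerivAt F (R y)⁻¹ y := fun t =>
    intervalIntegral.integral_hasDerivAt_right (hRi.intervalIntegrable _ _)
      (hRi.stronglyMeasurableAtFilter _ _) hRi.continuousAt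
  have hFc : Continuous F := continuous_iff_continuousAt.2 fun y => (hF y).continuousAt
  have hFmono : StrictMono F := by
    apply strictMono_of_deriv_pos
    intro y
    rw [(hF y).deriv]
    exact inv_pos.2 (hR0 y)
  have hmono2 : Monotone fun y => F y - B⁻¹ * y := by
    apply monotone_of_deriv_nonneg
    · intro y
      exact ((hF y).sub ((hasDerivAt_id y).const_mul B⁻¹)).differentiableAt
    · intro y
      have := ((hF y).sub ((hasDerivAt_id y).const_mul B⁻¹)).deriv
      have h2 := inv_anti₀ (hR0 y) (hB y)
      change 0 ≤ deriv (F - fun y => B⁻¹ * id y) y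
      rw [this]; linarith
  have hF0 : F 0 = 0 := intervalIntegral.integral_same
  have hFsurj : Function.Surjective F := by
    apply hFc.surjective
    · refine tendsto_atTop_mono' _ ?_ (tendsto_id.const_mul_atTop (inv_pos.2 hBpos))
      filter_upwards [eventually_ge_atTop 0] with y hy
      have := hmono2 hy
      simp only [hF0, id] at *; linarith
    · refine tendsto_atBot_mono' _ ?_ (tendsto_id.const_mul_atBot (inv_pos.2 hBpos))
      filter_upwards [eventually_le_atBot 0] with y hy
      have := hmono2 hy
      simp only [hF0, id] at *; linarith
  let e := StrictMono.orderIsoOfSurjective F hFmono hFsurj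
  have hGF : ∀ t, F (e.symm t) = t := fun t => e.apply_symm_apply t
  have hG : ∀ t, HasDerivAt e.symm (R (e.symm t)) t := by
    intro t
    have := HasDerivAt.of_local_left_inverse (f := F) (g := e.symm) (a := t)
      e.symm.continuous.continuousAt (hF _) (inv_pos.2 (hR0 _)).ne' (Eventually.of_forall hGF)
    simpa using this
  have hFY : F Y = riccatiTime p κ Y m := by
    apply intervalIntegral.integral_congr
    intro y hy
    rw [Set.uIcc_of_le hY] at hy
    simp only [R]
    rw [min_eq_left hy.2, max_eq_right hy.1]
  refine ⟨fun x => e.symm (riccatiTime p κ Y m - x), fun x hx => ?_⟩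
  have h0 : 0 ≤ e.symm (riccatiTime p κ Y m - x) := by
    apply hFmono.le_iff_le.1
    rw [hGF, hF0]; linarith [hx.2]
  have h1 : e.symm (riccatiTime p κ Y m - x) ≤ Y := by
    apply hFmono.le_iff_le.1
    rw [hGF, hFY]; linarith [hx.1]
  refine ⟨h0, ?_⟩
  have := (hG (riccatiTime p κ Y m - x)).comp x ((hasDerivAt_id x).const_sub _)
  simp only [R] at this
  rw [min_eq_left h1, max_eq_right h0] at this
  simpa [Function.comp_def] using this

/-- Mixed (Dirichlet at `0`, free at `x`) weighted Poincaré inequality, via a Riccati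
supersolution. -/
theorem integral_exp_mul_sub_nonneg {p κ Y m x : ℝ} (hp : 2 ≤ p) (hκ : 0 < κ) (hY : 0 ≤ Y)
    {f : ℝ → ℝ} (hf : ContDiff ℝ 1 f) (hf0 : f 0 = 0)
    (hx0 : 0 ≤ x) (hx : x ≤ riccatiTime p κ Y m) :
    0 ≤ ∫ t in (0:ℝ)..x, Real.exp (m * t) * (|deriv f t| ^ p - κ * |f t| ^ p) := by
  obtain ⟨φ, hφ⟩ := exists_riccati_supersolution (m := m) hp hκ hY
  have hfc := hf.continuous
  have hfc' : Continuous (deriv f) := hf.continuous_deriv le_rfl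
  set g : ℝ → ℝ := fun t => Real.exp (m * t) * (|deriv f t| ^ p - κ * |f t| ^ p) with hg
  have hp0 : 0 ≤ p := by linarith
  have hgc : Continuous g := by
    rw [hg]; fun_prop (disch := exact hp0)
  set J : ℝ → ℝ := fun s => (∫ t in (0:ℝ)..s, g t) - |f s| ^ p * φ s * Real.exp (m * s) with hJ
  have hJd : ∀ s ∈ Set.Icc 0 x, HasDerivAt J (g s - ((p * |f s| ^ (p - 2) * f s * deriv f s * φ s
      + |f s| ^ p * (-riccatiRhs p κ m (φ s))) * Real.exp (m * s)
      + |f s| ^ p * φ s * (Real.exp (m * s) * m))) s := by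
    intro s hs
    have h1 : HasDerivAt (fun s => ∫ t in (0:ℝ)..s, g t) (g s) s :=
      intervalIntegral.integral_hasDerivAt_right (hgc.intervalIntegrable _ _)
        (hgc.stronglyMeasurableAtFilter _ _) hgc.continuousAt
    have h2 : HasDerivAt (fun s => |f s| ^ p) (p * |f s| ^ (p - 2) * f s * deriv f s) s :=
      (hasDerivAt_abs_rpow (f s) (by linarith)).comp s
        ((hf.differentiable one_ne_zero) s).hasDerivAt
    have h3 := (hφ s ⟨hs.1, hs.2.trans hx⟩).2
    have h4 : HasDerivAt (fun s => Real.exp (m * s)) (Real.exp (m * s) * m) s := by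
      refine (((hasDerivAt_id s).const_mul m).exp).congr_deriv ?_
      simp only [id]; ring
    exact h1.sub ((h2.mul h3).mul h4)
  have hmono : MonotoneOn J (Set.Icc 0 x) := by
    apply monotoneOn_of_deriv_nonneg (convex_Icc _ _)
    · exact fun s hs => (hJd s hs).continuousAt.continuousWithinAt
    · intro s hs
      rw [interior_Icc] at hs
      exact (hJd s (Set.Ioo_subset_Icc_self hs)).differentiableAt.differentiableWithinAt
    · intro s hs
      rw [interior_Icc] at hs
      rw [(hJd s (Set.Ioo_subset_Icc_self hs)).deriv]
      have hφ0 := (hφ s ⟨hs.1.le, hs.2.le.trans hx⟩).1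
      have hY := young_riccati hp (abs_nonneg (f s)) (abs_nonneg (deriv f s)) hφ0
      have hR : κ + m * φ s + (p - 1) * φ s ^ (p / (p - 1)) ≤ riccatiRhs p κ m (φ s) := by
        unfold riccatiRhs
        rw [abs_of_nonneg hφ0]
        exact le_max_right _ _
      have hfp : 0 ≤ |f s| ^ p := by positivity
      have h5 : |f s| ^ (p - 2) * f s * deriv f s * φ s ≤
          |f s| ^ (p - 1) * |deriv f s| * φ s := by
        apply mul_le_mul_of_nonneg_right _ hφ0
        have : |f s| ^ (p - 1) = |f s| ^ (p - 2) * |f s| := by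
          rw [show p - 1 = (p - 2) + 1 by ring, Real.rpow_add_one' (abs_nonneg _) (by linarith)]
        rw [this, mul_assoc, mul_assoc, ← abs_mul]
        exact mul_le_mul_of_nonneg_left (le_abs_self _) (by positivity)
      have h6 := mul_le_mul_of_nonneg_left hR hfp
      have h7 := mul_le_mul_of_nonneg_left h5 hp0
      have : 0 ≤ Real.exp (m * s) * ((|deriv f s| ^ p - κ * |f s| ^ p)
          - (p * (|f s| ^ (p - 2) * f s * deriv f s * φ s)
            - |f s| ^ p * riccatiRhs p κ m (φ s)) - |f s| ^ p * φ s * m) := by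
        apply mul_nonneg (Real.exp_pos _).le
        nlinarith
      simp only [hg]
      linarith
  have h := hmono ⟨le_rfl, hx0⟩ ⟨hx0, le_rfl⟩ hx0
  have hφx := (hφ x ⟨hx0, hx⟩).1
  have hpz : (0:ℝ) ^ p = 0 := Real.zero_rpow (by linarith)
  simp only [hJ, intervalIntegral.integral_same, hf0, abs_zero, hpz, zero_mul, sub_zero] at h
  have : 0 ≤ |f x| ^ p * φ x * Real.exp (m * x) := by positivity
  linarith

/-- Second mean value principle: nonnegativity of all initial integrals is preserved under
multiplication by a nonnegative decreasing weight. -/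
theorem integral_mul_nonneg_of_antitone {L : ℝ} (hL : 0 ≤ L) {g k : ℝ → ℝ}
    (hg : Continuous g) (hgi : ∀ x ∈ Set.Icc 0 L, 0 ≤ ∫ t in (0:ℝ)..x, g t)
    (hk : Antitone k) (hk0 : ∀ x, 0 ≤ k x) (hkc : Continuous k) :
    0 ≤ ∫ t in (0:ℝ)..L, g t * k t := by
  have hA : MeasurableSet {z : ℝ × ℝ | z.2 < k z.1} :=
    measurableSet_lt measurable_snd (hkc.measurable.comp measurable_fst)
  have hint : Integrable (Function.uncurry fun t s : ℝ =>
      {z : ℝ × ℝ | z.2 < k z.1}.indicator (fun z => g z.1) (t, s))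
      ((volume.restrict (Set.Ioc 0 L)).prod (volume.restrict (Set.Ioc 0 (k 0)))) := by
    have h1 : Integrable g (volume.restrict (Set.Ioc 0 L)) :=
      (hg.integrableOn_Icc (a := 0) (b := L)).mono_set Set.Ioc_subset_Icc_self
    exact (h1.comp_fst _).indicator hA
  have hswap := MeasureTheory.integral_integral_swap hint
  have hL1 : ∫ t in (0:ℝ)..L, g t * k t = ∫ t in Set.Ioc 0 L, ∫ s in Set.Ioc 0 (k 0),
      {z : ℝ × ℝ | z.2 < k z.1}.indicator (fun z => g z.1) (t, s) := by
    rw [intervalIntegral.integral_of_le hL]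
    refine setIntegral_congr_fun measurableSet_Ioc fun t ht => ?_
    have hkt : k t ≤ k 0 := hk ht.1.le
    have : (fun s => {z : ℝ × ℝ | z.2 < k z.1}.indicator (fun z => g z.1) (t, s))
        = (Set.Iio (k t)).indicator fun _ => g t := by
      ext s; simp [Set.indicator]
    simp only [this]
    rw [integral_indicator measurableSet_Iio, Measure.restrict_restrict measurableSet_Iio,
      setIntegral_const]
    have hae : (Set.Iio (k t) ∩ Set.Ioc 0 (k 0) : Set ℝ) =ᵐ[volume] Set.Ioc 0 (k t) := by
      have h2 : (Set.Iio (k t) ∩ Set.Ioc 0 (k 0) : Set ℝ) = Set.Ioo 0 (k t) := by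
        ext s; simp only [Set.mem_inter_iff, Set.mem_Iio, Set.mem_Ioc, Set.mem_Ioo]
        constructor
        · rintro ⟨h1, h2, h3⟩; exact ⟨h2, h1⟩
        · rintro ⟨h1, h2⟩; exact ⟨h2, h1, by linarith⟩
      rw [h2]; exact Ioo_ae_eq_Ioc
    rw [measureReal_congr hae]
    simp [hk0 t, mul_comm]
  rw [hL1, hswap]
  refine setIntegral_nonneg measurableSet_Ioc fun s hs => ?_
  have h3 : (fun t => {z : ℝ × ℝ | z.2 < k z.1}.indicator (fun z => g z.1) (t, s))
        = {t | s < k t}.indicator g := by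
      ext t; simp [Set.indicator]
  have hm : MeasurableSet {t | s < k t} := measurableSet_lt measurable_const hkc.measurable
  simp only [h3]
  rw [integral_indicator hm, Measure.restrict_restrict hm]
  set S := {t | s < k t} ∩ Set.Ioc 0 L with hS
  rcases S.eq_empty_or_nonempty with h | hne
  · simp [h]
  have hbdd : BddAbove S := ⟨L, fun t ht => ht.2.2⟩
  have hcL : sSup S ≤ L := csSup_le hne fun t ht => ht.2.2
  have hc0 : 0 ≤ sSup S := by
    obtain ⟨t, ht⟩ := hne
    exact ht.2.1.le.trans (le_csSup hbdd ht)
  have hae : S =ᵐ[volume] Set.Ioc 0 (sSup S) := by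
    refine Filter.EventuallyLE.antisymm (Filter.Eventually.of_forall fun t ht => ?_) ?_
    · exact ⟨ht.2.1, le_csSup hbdd ht⟩
    · refine Ioo_ae_eq_Ioc.symm.le.trans (Filter.Eventually.of_forall fun t ht => ?_)
      obtain ⟨r, hr, htr⟩ := exists_lt_of_lt_csSup hne ht.2
      exact ⟨lt_of_lt_of_le hr.1 (hk htr.le), ht.1, ht.2.le.trans hcL⟩
  rw [setIntegral_congr_set hae, ← intervalIntegral.integral_of_le hc0]
  exact hgi _ ⟨hc0, hcL⟩

theorem integral_mul_nonneg_of_antitoneOn {L : ℝ} (hL : 0 ≤ L) {g k : ℝ → ℝ}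
    (hg : Continuous g) (hgi : ∀ x ∈ Set.Icc 0 L, 0 ≤ ∫ t in (0:ℝ)..x, g t)
    (hk : AntitoneOn k (Set.Icc 0 L)) (hk0 : ∀ x ∈ Set.Icc 0 L, 0 ≤ k x)
    (hkc : ContinuousOn k (Set.Icc 0 L)) :
    0 ≤ ∫ t in (0:ℝ)..L, g t * k t := by
  have h := integral_mul_nonneg_of_antitone hL (k := fun t => k (Set.projIcc 0 L hL t)) hg hgi
    (fun x y h => hk (Subtype.coe_prop _) (Subtype.coe_prop _) (Set.monotone_projIcc hL h))
    (fun x => hk0 _ (Subtype.coe_prop _))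
    (hkc.comp_continuous (continuous_subtype_val.comp continuous_projIcc)
      fun x => Subtype.coe_prop _)
  rw [intervalIntegral.integral_congr (g := fun t => g t * k (Set.projIcc 0 L hL t))]
  · exact h
  · intro t ht
    rw [Set.uIcc_of_le hL] at ht
    simp [Set.projIcc_of_mem hL ht]

theorem integral_exp_mul_sub_nonneg_of_antitoneOn {p κ Y m L : ℝ} (hp : 2 ≤ p) (hκ : 0 < κ)
    (hY : 0 ≤ Y) {v η : ℝ → ℝ} (hv : ContDiff ℝ 1 v) (hL : 0 ≤ L)
    (hLT : L ≤ riccatiTime p κ Y m) (hηc : ContinuousOn η (Set.Icc 0 L))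
    (hη : AntitoneOn (fun t => η t - m * t) (Set.Icc 0 L)) :
    0 ≤ ∫ t in (0:ℝ)..L, Real.exp (η t) * (|deriv v t| ^ p - κ * |v t - v 0| ^ p) := by
  have hp0 : 0 ≤ p := by linarith
  have hvc := hv.continuous
  have hvc' : Continuous (deriv v) := hv.continuous_deriv le_rfl
  have h := integral_mul_nonneg_of_antitoneOn hL (k := fun t => Real.exp (η t - m * t))
    (g := fun t => Real.exp (m * t) * (|deriv v t| ^ p - κ * |v t - v 0| ^ p))
    (by fun_prop (disch := exact hp0)) ?_ (fun x hx y hy h => Real.exp_le_exp.2 (hη hx hy h))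
    (fun x _ => (Real.exp_pos _).le) (by fun_prop)
  · refine h.trans_eq (intervalIntegral.integral_congr fun t _ => ?_)
    rw [Real.exp_sub]
    field_simp
  · intro x hx
    have h1 := integral_exp_mul_sub_nonneg (m := m) hp hκ hY (f := fun t => v t - v 0)
      (hv.sub contDiff_const) (by simp) hx.1 (hx.2.trans hLT)
    simpa only [deriv_sub_const] using h1

/-- One-dimensional weighted Poincaré inequality for log-concave weights, with the optimal
constant approached from below. -/
theorem exists_integral_exp_mul_sub_nonneg {p κ d a b : ℝ} (hp : 2 ≤ p) (hκ : 0 < κ) (hd : 0 < d)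
    (hκd : κ < (2*π*(p-1)^(1/p)/(p*Real.sin (π/p))/d)^p) (hab : a ≤ b) (hbd : b - a ≤ d)
    {v η : ℝ → ℝ} (hv : ContDiff ℝ 1 v) (hη : ConcaveOn ℝ (Set.Icc a b) η)
    (hηc : ContinuousOn η (Set.Icc a b)) :
    ∃ c ∈ Set.Icc a b,
      0 ≤ ∫ t in a..b, Real.exp (η t) * (|deriv v t| ^ p - κ * |v t - v c| ^ p) := by
  obtain ⟨Y, hY1, hY, hdY⟩ := exists_lt_two_mul_integral hp hd hκ hκd (κ * d)
  obtain ⟨M, hM, hdM⟩ := exists_le_riccatiTime_neg hp hκ hY hY1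
  obtain ⟨c, hc, m, hT1, hT2, hη1, hη2⟩ := exists_balanced_point
    (continuous_riccatiTime hp hκ Y) (antitone_riccatiTime hp hκ hY.le)
    hab (sub_pos.2 hdY) (fun m => by
      have := riccatiTime_add_ge hp hκ hY.le m
      linarith) hM (hbd.trans hdM) hη hηc
  refine ⟨c, hc, ?_⟩
  have hp0 : 0 ≤ p := by linarith
  have hvc := hv.continuous
  have hvc' : Continuous (deriv v) := hv.continuous_deriv le_rfl
  set F : ℝ → ℝ := fun t => Real.exp (η t) * (|deriv v t| ^ p - κ * |v t - v c| ^ p) with hF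
  have hFc : ContinuousOn F (Set.Icc a b) :=
    (Real.continuous_exp.comp_continuousOn hηc).mul
      (by fun_prop (disch := exact hp0) : Continuous
        fun t => |deriv v t| ^ p - κ * |v t - v c| ^ p).continuousOn
  have hR : 0 ≤ ∫ t in c..b, F t := by
    have h := integral_exp_mul_sub_nonneg_of_antitoneOn (v := fun t => v (c + t))
      (η := fun t => η (c + t)) (m := m) hp hκ hY.le (by fun_prop) (sub_nonneg.2 hc.2) hT1
      (hηc.comp (by fun_prop) fun t ht => ⟨by linarith [ht.1, hc.1], by linarith [ht.2]⟩)
      (fun x hx y hy hxy => by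
        have := hη1 (a := c + x) (b := c + y) ⟨by linarith [hx.1], by linarith [hx.2]⟩
          ⟨by linarith [hy.1], by linarith [hy.2]⟩ (by linarith)
        simp only at this ⊢
        linarith)
    have h2 := intervalIntegral.integral_comp_add_left (a := 0) (b := b - c) F c
    rw [add_zero, add_sub_cancel] at h2
    rw [← h2]
    simpa only [hF, deriv_comp_const_add, add_zero] using h
  have hLf : 0 ≤ ∫ t in a..c, F t := by
    have h := integral_exp_mul_sub_nonneg_of_antitoneOn (v := fun t => v (c - t))
      (η := fun t => η (c - t)) (m := -m) hp hκ hY.le (by fun_prop) (sub_nonneg.2 hc.1) hT2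
      (hηc.comp (by fun_prop) fun t ht => ⟨by linarith [ht.2, hc.1], by linarith [ht.1, hc.2]⟩)
      (fun x hx y hy hxy => by
        have := hη2 (a := c - y) (b := c - x) ⟨by linarith [hy.2], by linarith [hy.1]⟩
          ⟨by linarith [hx.2], by linarith [hx.1]⟩ (by linarith)
        simp only at this ⊢
        linarith)
    have h2 := intervalIntegral.integral_comp_sub_left (a := 0) (b := c - a) F c
    rw [sub_zero, sub_sub_cancel] at h2
    rw [← h2]
    simpa only [hF, deriv_comp_const_sub, sub_zero, abs_neg] using h
  rw [← intervalIntegral.integral_add_adjacent_intervals (b := c)]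
  · exact add_nonneg hLf hR
  · apply ContinuousOn.intervalIntegrable
    rw [Set.uIcc_of_le hc.1]; exact hFc.mono (Set.Icc_subset_Icc_right hc.2)
  · apply ContinuousOn.intervalIntegrable
    rw [Set.uIcc_of_le hc.2]; exact hFc.mono (Set.Icc_subset_Icc_left hc.1)

/-- Bounded measurable log-concave weights whose support has diameter at most `d`. -/
structure IsLogConcaveWeight {E : Type*} [NormedAddCommGroup E] [InnerProductSpace ℝ E]
    [MeasurableSpace E] (d : ℝ) (w : E → ℝ) : Prop where
  nonneg : ∀ x, 0 ≤ w x
  measurable : Measurable w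
  bounded : ∃ B, ∀ x, w x ≤ B
  dist_le : ∀ x y, w x ≠ 0 → w y ≠ 0 → dist x y ≤ d
  logConcave : ∀ x y : E, ∀ s t : ℝ, 0 < s → 0 < t → s + t = 1 →
    w x ^ s * w y ^ t ≤ w (s • x + t • y)

/-- The weighted Poincaré inequality for the class of log-concave weights with support of
diameter at most `d`. -/
def WeightedPoincare (E : Type*) [NormedAddCommGroup E] [InnerProductSpace ℝ E]
    [MeasureSpace E] (p κ d : ℝ) : Prop :=
  ∀ w : E → ℝ, IsLogConcaveWeight d w → ∀ v : E → ℝ, ContDiff ℝ 1 v → HasCompactSupport v →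
    ∀ δ : ℝ, 0 < δ → ∃ k : ℝ,
      κ * ∫ x, w x * |v x - k| ^ p ≤ (∫ x, w x * ‖fderiv ℝ v x‖ ^ p) + δ

namespace IsLogConcaveWeight

variable {E : Type*} [NormedAddCommGroup E] [InnerProductSpace ℝ E] {d : ℝ} {w : E → ℝ}

theorem convex_support [MeasurableSpace E] (hw : IsLogConcaveWeight d w) :
    Convex ℝ {x | w x ≠ 0} := by
  rw [convex_iff_forall_pos]
  intro x hx y hy s t hs ht hst
  have h := hw.logConcave x y s t hs ht hst
  have h1 : 0 < w x := lt_of_le_of_ne (hw.nonneg x) (Ne.symm hx)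
  have h2 : 0 < w y := lt_of_le_of_ne (hw.nonneg y) (Ne.symm hy)
  have : 0 < w x ^ s * w y ^ t := by positivity
  exact (this.trans_le h).ne'

theorem concaveOn_log [MeasurableSpace E] (hw : IsLogConcaveWeight d w) :
    ConcaveOn ℝ {x | w x ≠ 0} fun x => Real.log (w x) := by
  rw [concaveOn_iff_forall_pos]
  refine ⟨hw.convex_support, fun x hx y hy s t hs ht hst => ?_⟩
  have h := hw.logConcave x y s t hs ht hst
  have h1 : 0 < w x := lt_of_le_of_ne (hw.nonneg x) (Ne.symm hx)
  have h2 : 0 < w y := lt_of_le_of_ne (hw.nonneg y) (Ne.symm hy)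
  have := Real.log_le_log (by positivity) h
  rwa [Real.log_mul (by positivity) (by positivity), Real.log_rpow h1, Real.log_rpow h2] at this

theorem integrable_mul [FiniteDimensional ℝ E] [MeasurableSpace E] [BorelSpace E]
    {μ : Measure E} [IsFiniteMeasureOnCompacts μ]
    (hw : IsLogConcaveWeight d w) {F : E → ℝ} (hF : Continuous F) :
    Integrable (fun x => w x * F x) μ := by
  by_cases h : ∀ x, w x = 0
  · simp [h]
  push Not at h
  obtain ⟨x₀, hx₀⟩ := h
  obtain ⟨B, hB⟩ := hw.bounded
  obtain ⟨C, hC⟩ := (isCompact_closedBall x₀ d).exists_bound_of_continuousOn hF.continuousOn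
  have hs : Function.support (fun x => w x * F x) ⊆ Metric.closedBall x₀ d := by
    intro x hx
    exact hw.dist_le x x₀ (left_ne_zero_of_mul hx) hx₀
  rw [← integrableOn_iff_integrable_of_support_subset hs]
  refine IntegrableOn.of_bound (isCompact_closedBall x₀ d).measure_lt_top
    (hw.measurable.mul hF.measurable).aestronglyMeasurable (B * C) ?_
  refine (ae_restrict_iff' Metric.isClosed_closedBall.measurableSet).2 (ae_of_all _ fun x hx => ?_)
  rw [norm_mul, Real.norm_of_nonneg (hw.nonneg x)]
  exact mul_le_mul (hB x) (hC x hx) (norm_nonneg _) ((hw.nonneg x).trans (hB x))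

theorem integrable [FiniteDimensional ℝ E] [MeasurableSpace E] [BorelSpace E]
    {μ : Measure E} [IsFiniteMeasureOnCompacts μ] (hw : IsLogConcaveWeight d w) :
    Integrable w μ := by
  simpa using hw.integrable_mul (μ := μ) (continuous_const (y := (1:ℝ)))

end IsLogConcaveWeight

theorem weightedPoincare_real {p κ d : ℝ} (hp : 2 ≤ p) (hκ : 0 < κ) (hd : 0 < d)
    (hκd : κ < (2*π*(p-1)^(1/p)/(p*Real.sin (π/p))/d)^p) : WeightedPoincare ℝ p κ d := by
  intro w hw v hv hvs δ hδ
  have hp0 : 0 ≤ p := by linarith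
  have hvc := hv.continuous
  have hvc' : Continuous (deriv v) := hv.continuous_deriv le_rfl
  simp only [← norm_deriv_eq_norm_fderiv, Real.norm_eq_abs]
  set S : Set ℝ := {x | w x ≠ 0} with hS
  have hD0 : 0 ≤ ∫ x, w x * |deriv v x| ^ p :=
    integral_nonneg fun x => mul_nonneg (hw.nonneg x) (by positivity)
  rcases S.eq_empty_or_nonempty with h | hne
  · refine ⟨0, ?_⟩
    have : ∀ x, w x = 0 := fun x => by
      by_contra hx
      exact (h ▸ (show x ∈ S from hx) : x ∈ (∅ : Set ℝ))
    simp [this, hδ.le]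
  obtain ⟨x₀, hx₀⟩ := id hne
  have hbelow : BddBelow S := ⟨x₀ - d, fun x hx => by
    have := abs_le.1 (hw.dist_le x x₀ hx hx₀); linarith [this.1]⟩
  have habove : BddAbove S := ⟨x₀ + d, fun x hx => by
    have := abs_le.1 (hw.dist_le x x₀ hx hx₀); linarith [this.2]⟩
  set a := sInf S with ha
  set b := sSup S with hb
  have hSI : S ⊆ Set.Icc a b := subset_Icc_csInf_csSup hbelow habove
  have hab : a ≤ b := (hSI hx₀).1.trans (hSI hx₀).2
  have hIS : Set.Ioo a b ⊆ S :=
    IsConnected.Ioo_csInf_csSup_subset ⟨hne, hw.convex_support.isPreconnected⟩ hbelow habove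
  have hbd : b - a ≤ d := by
    rw [sub_le_iff_le_add]
    apply csSup_le hne
    intro x hx
    rw [← sub_le_iff_le_add']
    apply le_csInf hne
    intro y hy
    have := abs_le.1 (hw.dist_le x y hx hy); linarith [this.2]
  obtain ⟨B, hB⟩ := hw.bounded
  obtain ⟨V, hV⟩ := hvc.bounded_above_of_compact_support hvs
  have hB0 : 0 ≤ B := (hw.nonneg x₀).trans (hB x₀)
  have hV0 : 0 ≤ V := (norm_nonneg _).trans (hV x₀)
  set C := κ * (B * (2 * V) ^ p) with hC
  have hC0 : 0 ≤ C := by positivity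
  have key : ∀ F : ℝ → ℝ, ∫ x, w x * F x = ∫ x in a..b, w x * F x := by
    intro F
    rw [intervalIntegral.integral_of_le hab, ← integral_Icc_eq_integral_Ioc,
      setIntegral_eq_integral_of_forall_compl_eq_zero]
    intro x hx
    have : w x = 0 := by
      by_contra h
      exact hx (hSI h)
    simp [this]
  obtain ⟨τ, hτ0, hτ⟩ : ∃ τ, 0 < τ ∧ C * (2 * τ) ≤ δ := by
    refine ⟨δ / (2 * (C + 1)), by positivity, ?_⟩
    rw [show C * (2 * (δ / (2 * (C + 1)))) = δ * (C / (C + 1)) by field_simp]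
    exact mul_le_of_le_one_right hδ.le ((div_le_one (by positivity)).2 (by linarith))
  have bound : ∀ c x, κ * (w x * |v x - v c| ^ p) ≤ C := by
    intro c x
    rw [hC]
    gcongr
    · exact hB x
    · have h1 := abs_le.1 (hV x)
      have h2 := abs_le.1 (hV c)
      exact abs_le.2 ⟨by linarith, by linarith⟩
  have hint : ∀ F : ℝ → ℝ, Continuous F → ∀ x y, IntervalIntegrable (fun x => w x * F x) volume x y :=
    fun F hF x y => (hw.integrable_mul hF).intervalIntegrable
  have small : ∀ c x y, x ≤ y → κ * ∫ t in x..y, w t * |v t - v c| ^ p ≤ C * (y - x) := by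
    intro c x y hxy
    rw [← intervalIntegral.integral_const_mul]
    have := intervalIntegral.integral_mono_on (μ := volume) hxy
      ((hint (fun t => |v t - v c| ^ p) (by fun_prop (disch := exact hp0)) x y).const_mul κ)
      (intervalIntegrable_const (c := C)) (fun t _ => bound c t)
    simpa [mul_comm] using this
  rcases le_or_gt (b - a) (2 * τ) with hsm | hbig
  · refine ⟨v x₀, ?_⟩
    rw [key]
    have := small x₀ a b hab
    nlinarith
  have hsub : Set.Icc (a + τ) (b - τ) ⊆ Set.Ioo a b := fun x hx =>
    ⟨by linarith [hx.1], by linarith [hx.2]⟩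
  obtain ⟨c, hc, h⟩ := exists_integral_exp_mul_sub_nonneg hp hκ hd hκd (a := a + τ) (b := b - τ)
    (by linarith) (by linarith) hv
    (hw.concaveOn_log.subset (hsub.trans hIS) (convex_Icc _ _))
    (((hw.concaveOn_log.subset hIS (convex_Ioo _ _)).continuousOn isOpen_Ioo).mono hsub)
  refine ⟨v c, ?_⟩
  have h1 : ∫ t in (a + τ)..(b - τ), Real.exp (Real.log (w t)) *
      (|deriv v t| ^ p - κ * |v t - v c| ^ p) = (∫ t in (a + τ)..(b - τ), w t * |deriv v t| ^ p) -
        κ * ∫ t in (a + τ)..(b - τ), w t * |v t - v c| ^ p := by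
    rw [← intervalIntegral.integral_const_mul, ← intervalIntegral.integral_sub
      (hint _ (by fun_prop (disch := exact hp0)) _ _)
      ((hint _ (by fun_prop (disch := exact hp0)) _ _).const_mul _)]
    refine intervalIntegral.integral_congr fun t ht => ?_
    rw [Set.uIcc_of_le (by linarith)] at ht
    have : 0 < w t := lt_of_le_of_ne (hw.nonneg t) (Ne.symm (hIS (hsub ht)))
    simp only [Real.exp_log this]
    ring
  rw [h1] at h
  have h2 : ∫ t in (a + τ)..(b - τ), w t * |deriv v t| ^ p ≤ ∫ x, w x * |deriv v x| ^ p := by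
    rw [intervalIntegral.integral_of_le (by linarith)]
    exact setIntegral_le_integral (hw.integrable_mul (by fun_prop (disch := exact hp0)))
      (ae_of_all _ fun x => mul_nonneg (hw.nonneg x) (by positivity))
  have hi := hint (fun t => |v t - v c| ^ p) (by fun_prop (disch := exact hp0))
  rw [key, ← intervalIntegral.integral_add_adjacent_intervals (hi a (a + τ)) (hi (a + τ) b),
    ← intervalIntegral.integral_add_adjacent_intervals (hi (a + τ) (b - τ)) (hi (b - τ) b)]
  have h3 := small c a (a + τ) (by linarith)
  have h4 := small c (b - τ) b (by linarith)
  nlinarith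

theorem WeightedPoincare.of_linearIsometryEquiv {E E' : Type*} [NormedAddCommGroup E]
    [InnerProductSpace ℝ E] [MeasureSpace E] [BorelSpace E] [NormedAddCommGroup E']
    [InnerProductSpace ℝ E'] [MeasureSpace E'] [BorelSpace E'] {p κ d : ℝ}
    (e : E' ≃ₗᵢ[ℝ] E) (he : MeasurePreserving e) (h : WeightedPoincare E' p κ d) :
    WeightedPoincare E p κ d := by
  intro w hw v hv hvs δ hδ
  have hw' : IsLogConcaveWeight d (w ∘ e) := by
    refine ⟨fun x => hw.nonneg _, hw.measurable.comp he.measurable,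
      hw.bounded.imp fun B hB x => hB _, fun x y hx hy => ?_, fun x y s t hs ht hst => ?_⟩
    · simpa using hw.dist_le _ _ hx hy
    · simpa using hw.logConcave (e x) (e y) s t hs ht hst
  have hem : MeasurableEmbedding e := e.toHomeomorph.measurableEmbedding
  obtain ⟨k, hk⟩ := h _ hw' (v ∘ e) (hv.comp e.contDiff)
    (hvs.comp_homeomorph e.toHomeomorph) δ hδ
  refine ⟨k, ?_⟩
  have h1 := he.integral_comp hem (fun x => w x * |v x - k| ^ p)
  have h2 := he.integral_comp hem (fun x => w x * ‖fderiv ℝ v x‖ ^ p)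
  rw [← h1, ← h2]
  refine hk.trans_eq ?_
  congr 1
  refine integral_congr_ae (ae_of_all _ fun x => ?_)
  have : fderiv ℝ (v ∘ e) x = (fderiv ℝ v (e x)).comp (e.toContinuousLinearEquiv : E' →L[ℝ] E) :=
    e.toContinuousLinearEquiv.comp_right_fderiv
  have h3 : ‖fderiv ℝ (v ∘ e) x‖ = ‖fderiv ℝ v (e x)‖ := by
    rw [this]
    exact ContinuousLinearMap.opNorm_comp_linearIsometryEquiv _ e
  simp only [h3, Function.comp]

theorem weightedPoincare_one {p κ d : ℝ} (h : WeightedPoincare ℝ p κ d) :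
    WeightedPoincare (EuclideanSpace ℝ (Fin 1)) p κ d := by
  let e : ℝ ≃ₗᵢ[ℝ] EuclideanSpace ℝ (Fin 1) :=
    (stdOrthonormalBasis ℝ ℝ).equiv (stdOrthonormalBasis ℝ (EuclideanSpace ℝ (Fin 1)))
      (finCongr (by simp))
  exact h.of_linearIsometryEquiv e e.measurePreserving

/-- Orthogonal splitting of Euclidean space along a unit vector, in coordinates. -/
theorem exists_orthogonal_splitting {n : ℕ} (θ : EuclideanSpace ℝ (Fin (n + 1))) (hθ : ‖θ‖ = 1) :
    ∃ ι : EuclideanSpace ℝ (Fin n) →ₗᵢ[ℝ] EuclideanSpace ℝ (Fin (n + 1)),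
      (∀ z, ⟪θ, ι z⟫ = 0) ∧
      MeasurePreserving (fun q : EuclideanSpace ℝ (Fin n) × ℝ => ι q.1 + q.2 • θ) ∧
      MeasurableEmbedding (fun q : EuclideanSpace ℝ (Fin n) × ℝ => ι q.1 + q.2 • θ) ∧
      Function.Surjective (fun q : EuclideanSpace ℝ (Fin n) × ℝ => ι q.1 + q.2 • θ) := by
  let e₀ : (WithLp 2 (EuclideanSpace ℝ (Fin n) × ℝ)) ≃ₗᵢ[ℝ] EuclideanSpace ℝ (Fin (n + 1)) :=
    (stdOrthonormalBasis ℝ (WithLp 2 (EuclideanSpace ℝ (Fin n) × ℝ))).equiv (stdOrthonormalBasis ℝ _) (finCongr (by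
      rw [LinearEquiv.finrank_eq (WithLp.linearEquiv 2 ℝ ((EuclideanSpace ℝ (Fin n)) × ℝ))]
      simp))
  let ω : (WithLp 2 (EuclideanSpace ℝ (Fin n) × ℝ)) := WithLp.toLp 2 ((0 : (EuclideanSpace ℝ (Fin n))), (1 : ℝ))
  have hω : ‖ω‖ = 1 := by simp [ω]
  let R := (ℝ ∙ (e₀ ω - θ))ᗮ.reflection
  have hR : R (e₀ ω) = θ := Submodule.reflection_sub (by simp [hω, hθ])
  let e : (WithLp 2 (EuclideanSpace ℝ (Fin n) × ℝ)) ≃ₗᵢ[ℝ] EuclideanSpace ℝ (Fin (n + 1)) := e₀.trans R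
  have heω : e ω = θ := hR
  let ι : (EuclideanSpace ℝ (Fin n)) →ₗᵢ[ℝ] EuclideanSpace ℝ (Fin (n + 1)) :=
    { toLinearMap := e.toLinearEquiv.toLinearMap ∘ₗ
        (WithLp.linearEquiv 2 ℝ ((EuclideanSpace ℝ (Fin n)) × ℝ)).symm.toLinearMap ∘ₗ LinearMap.inl ℝ (EuclideanSpace ℝ (Fin n)) ℝ
      norm_map' := fun z => by simp }
  have hι : ∀ z, ι z = e (WithLp.toLp 2 (z, 0)) := fun z => rfl
  have hmap : (fun q : (EuclideanSpace ℝ (Fin n)) × ℝ => ι q.1 + q.2 • θ) = e ∘ (WithLp.toLp 2) := by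
    ext1 q
    rw [hι, ← heω, ← map_smul, ← map_add]
    simp only [Function.comp]
    congr 1
    apply WithLp.ofLp_injective
    ext1 <;> simp [ω]
  refine ⟨ι, fun z => ?_, ?_, ?_, ?_⟩
  · rw [hι, ← heω, LinearIsometryEquiv.inner_map_map]
    simp [ω, WithLp.prod_inner_apply]
  · rw [hmap]
    exact e.measurePreserving.comp (WithLp.volume_preserving_toLp (EuclideanSpace ℝ (Fin n)) ℝ)
  · rw [hmap]
    exact e.toHomeomorph.measurableEmbedding.comp
      (MeasurableEquiv.toLp 2 ((EuclideanSpace ℝ (Fin n)) × ℝ)).measurableEmbedding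
  · rw [hmap]
    exact e.surjective.comp (WithLp.toLp_surjective 2)

/-- One-dimensional Brunn–Minkowski inequality, for a convex set containing the combination. -/
theorem volume_add_le_of_smul_add_smul_mem {A B C : Set ℝ} {s t : ℝ} (hs : 0 < s) (ht : 0 < t)
    (hA : Bornology.IsBounded A) (hB : Bornology.IsBounded B) (hAn : A.Nonempty)
    (hBn : B.Nonempty) (hC : Convex ℝ C) (h : ∀ x ∈ A, ∀ y ∈ B, s * x + t * y ∈ C) :
    ENNReal.ofReal s * volume A + ENNReal.ofReal t * volume B ≤ volume C := by
  have hA1 := hA.bddBelow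
  have hA2 := hA.bddAbove
  have hB1 := hB.bddBelow
  have hB2 := hB.bddAbove
  have hsub : Set.Ioo (s * sInf A + t * sInf B) (s * sSup A + t * sSup B) ⊆ C := by
    intro z hz
    obtain ⟨x, hx, hx'⟩ : ∃ x ∈ A, s * x < s * sInf A + (z - (s * sInf A + t * sInf B)) / 2 := by
      obtain ⟨x, hx, h1⟩ := exists_lt_of_csInf_lt hAn
        (show sInf A < sInf A + (z - (s * sInf A + t * sInf B)) / 2 / s by
          have : 0 < (z - (s * sInf A + t * sInf B)) / 2 / s :=
            div_pos (by linarith [hz.1]) hs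
          linarith)
      refine ⟨x, hx, ?_⟩
      have := mul_lt_mul_of_pos_left h1 hs
      rwa [mul_add, mul_div_cancel₀ _ hs.ne'] at this
    obtain ⟨y, hy, hy'⟩ : ∃ x ∈ B, t * x < t * sInf B + (z - (s * sInf A + t * sInf B)) / 2 := by
      obtain ⟨x, hx, h1⟩ := exists_lt_of_csInf_lt hBn
        (show sInf B < sInf B + (z - (s * sInf A + t * sInf B)) / 2 / t by
          have : 0 < (z - (s * sInf A + t * sInf B)) / 2 / t :=
            div_pos (by linarith [hz.1]) ht
          linarith)
      refine ⟨x, hx, ?_⟩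
      have := mul_lt_mul_of_pos_left h1 ht
      rwa [mul_add, mul_div_cancel₀ _ ht.ne'] at this
    obtain ⟨x', hu, hu'⟩ : ∃ x ∈ A, s * sSup A - (s * sSup A + t * sSup B - z) / 2 < s * x := by
      obtain ⟨x, hx, h1⟩ := exists_lt_of_lt_csSup hAn
        (show sSup A - (s * sSup A + t * sSup B - z) / 2 / s < sSup A by
          have : 0 < (s * sSup A + t * sSup B - z) / 2 / s :=
            div_pos (by linarith [hz.2]) hs
          linarith)
      refine ⟨x, hx, ?_⟩
      have := mul_lt_mul_of_pos_left h1 hs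
      rwa [mul_sub, mul_div_cancel₀ _ hs.ne'] at this
    obtain ⟨y', hv, hv'⟩ : ∃ x ∈ B, t * sSup B - (s * sSup A + t * sSup B - z) / 2 < t * x := by
      obtain ⟨x, hx, h1⟩ := exists_lt_of_lt_csSup hBn
        (show sSup B - (s * sSup A + t * sSup B - z) / 2 / t < sSup B by
          have : 0 < (s * sSup A + t * sSup B - z) / 2 / t :=
            div_pos (by linarith [hz.2]) ht
          linarith)
      refine ⟨x, hx, ?_⟩
      have := mul_lt_mul_of_pos_left h1 ht
      rwa [mul_sub, mul_div_cancel₀ _ ht.ne'] at this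
    exact hC.ordConnected.out (h x hx y hy) (h x' hu y' hv) ⟨by linarith, by linarith⟩
  have hvol : ∀ {D : Set ℝ}, BddBelow D → BddAbove D →
      volume D ≤ ENNReal.ofReal (sSup D - sInf D) := by
    intro D h1 h2
    have := measure_mono (μ := volume) (subset_Icc_csInf_csSup h1 h2)
    rwa [Real.volume_Icc] at this
  have hnn : ∀ {D : Set ℝ}, BddBelow D → BddAbove D → D.Nonempty → 0 ≤ sSup D - sInf D :=
    fun h1 h2 h3 => sub_nonneg.2 (csInf_le_csSup h3 h1 h2)
  calc ENNReal.ofReal s * volume A + ENNReal.ofReal t * volume B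
      ≤ ENNReal.ofReal s * ENNReal.ofReal (sSup A - sInf A)
        + ENNReal.ofReal t * ENNReal.ofReal (sSup B - sInf B) := by
        gcongr
        · exact hvol hA1 hA2
        · exact hvol hB1 hB2
    _ = ENNReal.ofReal ((s * sSup A + t * sSup B) - (s * sInf A + t * sInf B)) := by
        rw [← ENNReal.ofReal_mul hs.le, ← ENNReal.ofReal_mul ht.le, ← ENNReal.ofReal_add
          (mul_nonneg hs.le (hnn hA1 hA2 hAn)) (mul_nonneg ht.le (hnn hB1 hB2 hBn))]
        congr 1; ring
    _ ≤ volume C := by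
        rw [← Real.volume_Ioo]
        exact measure_mono hsub

theorem lintegral_add_le_of_rpow_mul_rpow_le {f g h : ℝ → ℝ} {s t : ℝ} (hs : 0 < s) (ht : 0 < t)
    (hst : s + t = 1) (hf0 : ∀ x, 0 ≤ f x) (hg0 : ∀ x, 0 ≤ g x) (hh0 : ∀ x, 0 ≤ h x)
    (hfm : Measurable f) (hgm : Measurable g) (hhm : Measurable h)
    (hfb : Bornology.IsBounded {x | f x ≠ 0}) (hgb : Bornology.IsBounded {x | g x ≠ 0})
    (hf1 : ∀ x, f x ≤ 1) (hg1 : ∀ x, g x ≤ 1) (hf2 : ∀ l < 1, ∃ x, l < f x)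
    (hg2 : ∀ l < 1, ∃ x, l < g x) (hhc : ∀ l, 0 < l → Convex ℝ {x | l < h x})
    (hfg : ∀ x y, f x ^ s * g y ^ t ≤ h (s * x + t * y)) :
    ENNReal.ofReal s * (∫⁻ x, ENNReal.ofReal (f x)) + ENNReal.ofReal t *
      (∫⁻ x, ENNReal.ofReal (g x)) ≤ ∫⁻ x, ENNReal.ofReal (h x) := by
  rw [lintegral_eq_lintegral_meas_lt _ (ae_of_all _ hf0) hfm.aemeasurable,
    lintegral_eq_lintegral_meas_lt _ (ae_of_all _ hg0) hgm.aemeasurable,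
    lintegral_eq_lintegral_meas_lt _ (ae_of_all _ hh0) hhm.aemeasurable]
  have hanti : ∀ k : ℝ → ℝ, Measurable fun l => volume {x | l < k x} := fun k =>
    Antitone.measurable fun l l' hl => measure_mono fun x hx => lt_of_le_of_lt hl hx
  rw [← lintegral_const_mul _ (hanti f), ← lintegral_const_mul _ (hanti g),
    ← lintegral_add_left ((hanti f).const_mul _)]
  refine setLIntegral_mono (hanti h) fun l hl => ?_
  have hl : 0 < l := hl
  rcases lt_or_ge l 1 with hl1 | hl1
  · refine volume_add_le_of_smul_add_smul_mem hs ht (hfb.subset fun x hx => (hl.trans hx).ne')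
      (hgb.subset fun x hx => (hl.trans hx).ne') (hf2 l hl1) (hg2 l hl1) (hhc l hl)
      fun x hx y hy => ?_
    refine lt_of_lt_of_le ?_ (hfg x y)
    calc l = l ^ s * l ^ t := by rw [← Real.rpow_add hl, hst, Real.rpow_one]
      _ < f x ^ s * g y ^ t := by
        have h1 := Real.rpow_lt_rpow hl.le hx hs
        have h2 := Real.rpow_lt_rpow hl.le hy ht
        exact mul_lt_mul'' h1 h2 (by positivity) (by positivity)
  · have h1 : {x | l < f x} = ∅ := by
      ext x; simpa using (hf1 x).trans hl1
    have h2 : {x | l < g x} = ∅ := by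
      ext x; simpa using (hg1 x).trans hl1
    simp [h1, h2]

/-- One-dimensional Prékopa–Leindler inequality. -/
theorem integral_rpow_mul_integral_rpow_le {f g h : ℝ → ℝ} {s t : ℝ} (hs : 0 < s) (ht : 0 < t)
    (hst : s + t = 1) (hf0 : ∀ x, 0 ≤ f x) (hg0 : ∀ x, 0 ≤ g x) (hh0 : ∀ x, 0 ≤ h x)
    (hfm : Measurable f) (hgm : Measurable g) (hhm : Measurable h)
    (hfb : Bornology.IsBounded {x | f x ≠ 0}) (hgb : Bornology.IsBounded {x | g x ≠ 0})
    (hf1 : BddAbove (Set.range f)) (hg1 : BddAbove (Set.range g))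
    (hfi : Integrable f) (hgi : Integrable g) (hhi : Integrable h)
    (hhc : ∀ l, 0 < l → Convex ℝ {x | l < h x})
    (hfg : ∀ x y, f x ^ s * g y ^ t ≤ h (s * x + t * y)) :
    (∫ x, f x) ^ s * (∫ x, g x) ^ t ≤ ∫ x, h x := by
  by_cases hfz : ∀ x, f x = 0
  · simp only [hfz, integral_zero, Real.zero_rpow hs.ne', zero_mul]
    exact integral_nonneg hh0
  by_cases hgz : ∀ x, g x = 0
  · simp only [hgz, integral_zero, Real.zero_rpow ht.ne', mul_zero]
    exact integral_nonneg hh0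
  push Not at hfz hgz
  obtain ⟨x₀, hx₀⟩ := hfz
  obtain ⟨y₀, hy₀⟩ := hgz
  set F := ⨆ x, f x with hF
  set G := ⨆ x, g x with hG
  have hFx : ∀ x, f x ≤ F := le_ciSup hf1
  have hGx : ∀ x, g x ≤ G := le_ciSup hg1
  have hF0 : 0 < F := (lt_of_le_of_ne (hf0 _) (Ne.symm hx₀)).trans_le (hFx x₀)
  have hG0 : 0 < G := (lt_of_le_of_ne (hg0 _) (Ne.symm hy₀)).trans_le (hGx y₀)
  set H := F ^ s * G ^ t with hH
  have hH0 : 0 < H := by positivity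
  have key := lintegral_add_le_of_rpow_mul_rpow_le (f := fun x => f x / F) (g := fun x => g x / G)
    (h := fun x => h x / H) hs ht hst (fun x => div_nonneg (hf0 x) hF0.le)
    (fun x => div_nonneg (hg0 x) hG0.le) (fun x => div_nonneg (hh0 x) hH0.le)
    (hfm.div_const _) (hgm.div_const _) (hhm.div_const _)
    (hfb.subset fun x hx => by simpa [hF0.ne'] using hx)
    (hgb.subset fun x hx => by simpa [hG0.ne'] using hx)
    (fun x => (div_le_one hF0).2 (hFx x)) (fun x => (div_le_one hG0).2 (hGx x))
    (fun l hl => by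
      obtain ⟨x, hx⟩ := exists_lt_of_lt_ciSup (show l * F < ⨆ x, f x by nlinarith)
      exact ⟨x, (lt_div_iff₀ hF0).2 hx⟩)
    (fun l hl => by
      obtain ⟨x, hx⟩ := exists_lt_of_lt_ciSup (show l * G < ⨆ x, g x by nlinarith)
      exact ⟨x, (lt_div_iff₀ hG0).2 hx⟩)
    (fun l hl => by
      simp only [lt_div_iff₀ hH0]
      exact hhc _ (by positivity))
    (fun x y => by
      rw [Real.div_rpow (hf0 _) hF0.le, Real.div_rpow (hg0 _) hG0.le, div_mul_div_comm]
      exact div_le_div_of_nonneg_right (hfg x y) hH0.le)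
  rw [← ofReal_integral_eq_lintegral_ofReal (hfi.div_const _)
      (ae_of_all _ fun x => div_nonneg (hf0 x) hF0.le),
    ← ofReal_integral_eq_lintegral_ofReal (hgi.div_const _)
      (ae_of_all _ fun x => div_nonneg (hg0 x) hG0.le),
    ← ofReal_integral_eq_lintegral_ofReal (hhi.div_const _)
      (ae_of_all _ fun x => div_nonneg (hh0 x) hH0.le),
    integral_div, integral_div, integral_div] at key
  have hIf := integral_nonneg (μ := volume) (f := f) hf0
  have hIg := integral_nonneg (μ := volume) (f := g) hg0
  have hIh := integral_nonneg (μ := volume) (f := h) hh0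
  rw [← ENNReal.ofReal_mul hs.le, ← ENNReal.ofReal_mul ht.le,
    ← ENNReal.ofReal_add (by positivity) (by positivity),
    ENNReal.ofReal_le_ofReal_iff (by positivity)] at key
  have hag := Real.geom_mean_le_arith_mean2_weighted hs.le ht.le
    (div_nonneg hIf hF0.le) (div_nonneg hIg hG0.le) hst
  have := hag.trans key
  rw [Real.div_rpow hIf hF0.le, Real.div_rpow hIg hG0.le, div_mul_div_comm] at this
  exact (div_le_div_iff_of_pos_right hH0).1 this

namespace IsLogConcaveWeight

variable {E : Type*} [NormedAddCommGroup E] [InnerProductSpace ℝ E] [MeasurableSpace E]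
  {d : ℝ} {w : E → ℝ}

theorem convex_superlevel (hw : IsLogConcaveWeight d w) {l : ℝ} (hl : 0 < l) :
    Convex ℝ {x | l < w x} := by
  rw [convex_iff_forall_pos]
  intro x hx y hy s t hs ht hst
  refine lt_of_lt_of_le ?_ (hw.logConcave x y s t hs ht hst)
  calc l = l ^ s * l ^ t := by rw [← Real.rpow_add hl, hst, Real.rpow_one]
    _ < w x ^ s * w y ^ t := mul_lt_mul'' (Real.rpow_lt_rpow hl.le hx hs)
      (Real.rpow_lt_rpow hl.le hy ht) (by positivity) (by positivity)

theorem isBounded_support (hw : IsLogConcaveWeight d w) : Bornology.IsBounded {x | w x ≠ 0} :=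
  Metric.isBounded_iff.2 ⟨d, fun x hx y hy => hw.dist_le x y hx hy⟩

theorem slice [BorelSpace E] (hw : IsLogConcaveWeight d w) (a : E) {θ : E} (hθ : ‖θ‖ = 1) :
    IsLogConcaveWeight d fun s : ℝ => w (a + s • θ) where
  nonneg _ := hw.nonneg _
  measurable := hw.measurable.comp (by fun_prop : Continuous fun s : ℝ => a + s • θ).measurable
  bounded := hw.bounded.imp fun B hB x => hB _
  dist_le x y hx hy := by
    have := hw.dist_le _ _ hx hy
    rwa [dist_add_left, dist_eq_norm, ← sub_smul, norm_smul, hθ, mul_one, ← dist_eq_norm] at this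
  logConcave x y s t hs ht hst := by
    refine (hw.logConcave _ _ s t hs ht hst).trans_eq ?_
    congr 1
    rw [smul_add, smul_add, add_add_add_comm, ← add_smul, hst, one_smul, smul_smul, smul_smul,
      ← add_smul, smul_eq_mul, smul_eq_mul]

/-- Marginals of log-concave weights are log-concave. -/
theorem marginal {F : Type*} [NormedAddCommGroup F] [InnerProductSpace ℝ F]
    [FiniteDimensional ℝ F] [MeasurableSpace F] [BorelSpace F] [BorelSpace E]
    (hw : IsLogConcaveWeight d w) (ι : F →ₗᵢ[ℝ] E) {θ : E} (hθ : ‖θ‖ = 1)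
    (hort : ∀ z, ⟪θ, ι z⟫ = 0) (hm : Measurable fun q : F × ℝ => ι q.1 + q.2 • θ) :
    IsLogConcaveWeight d fun z => ∫ s : ℝ, w (ι z + s • θ) where
  nonneg _ := integral_nonneg fun _ => hw.nonneg _
  measurable := by
    have : StronglyMeasurable fun q : F × ℝ => w (ι q.1 + q.2 • θ) :=
      (hw.measurable.comp hm).stronglyMeasurable
    exact this.integral_prod_right.measurable
  bounded := by
    obtain ⟨B, hB⟩ := hw.bounded
    refine ⟨B * (2 * |d|), fun z => ?_⟩
    have hs := hw.slice (ι z) hθ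
    have hB0 : 0 ≤ B := (hw.nonneg 0).trans (hB 0)
    by_cases h : ∀ s : ℝ, w (ι z + s • θ) = 0
    · simp only [h, integral_zero]; positivity
    push Not at h
    obtain ⟨s₀, hs₀⟩ := h
    have hd : 0 ≤ d := by simpa using hs.dist_le s₀ s₀ hs₀ hs₀
    rw [← setIntegral_eq_integral_of_forall_compl_eq_zero (s := Set.Icc (s₀ - d) (s₀ + d))]
    · have := norm_setIntegral_le_of_norm_le_const (μ := volume) (C := B)
        (s := Set.Icc (s₀ - d) (s₀ + d)) (f := fun s => w (ι z + s • θ)) (by simp)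
        (fun s _ => by rw [Real.norm_of_nonneg (hw.nonneg _)]; exact hB _)
      refine (le_abs_self _).trans (this.trans_eq ?_)
      rw [Real.volume_real_Icc_of_le (by linarith), abs_of_nonneg hd]
      ring
    · intro s hs'
      by_contra hne
      have := abs_le.1 (hs.dist_le s s₀ hne hs₀)
      exact hs' ⟨by linarith [this.1], by linarith [this.2]⟩
  dist_le x y hx hy := by
    obtain ⟨s, hs⟩ : ∃ s : ℝ, w (ι x + s • θ) ≠ 0 := by
      by_contra h; push Not at h; simp [h] at hx
    obtain ⟨t, ht⟩ : ∃ s : ℝ, w (ι y + s • θ) ≠ 0 := by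
      by_contra h; push Not at h; simp [h] at hy
    refine le_trans ?_ (hw.dist_le _ _ hs ht)
    rw [dist_eq_norm, dist_eq_norm, ← ι.norm_map,
      show ι x + s • θ - (ι y + t • θ) = ι (x - y) + (s - t) • θ by
        rw [map_sub, sub_smul]; abel]
    have h1 : ⟪ι (x - y), (s - t) • θ⟫ = 0 := by
      rw [real_inner_comm, inner_smul_left, hort]; simp
    have h2 := norm_add_sq_eq_norm_sq_add_norm_sq_of_inner_eq_zero _ _ h1
    nlinarith [norm_nonneg (ι (x - y)), norm_nonneg (ι (x - y) + (s - t) • θ),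
      norm_nonneg ((s - t) • θ)]
  logConcave x y s t hs ht hst := by
    have hx := hw.slice (ι x) hθ
    have hy := hw.slice (ι y) hθ
    have hz := hw.slice (ι (s • x + t • y)) hθ
    refine integral_rpow_mul_integral_rpow_le hs ht hst hx.nonneg hy.nonneg hz.nonneg
      hx.measurable hy.measurable hz.measurable hx.isBounded_support hy.isBounded_support
      ?_ ?_ hx.integrable hy.integrable hz.integrable (fun l hl => hz.convex_superlevel hl) ?_
    · obtain ⟨B, hB⟩ := hx.bounded
      exact ⟨B, Set.forall_mem_range.2 hB⟩
    · obtain ⟨B, hB⟩ := hy.bounded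
      exact ⟨B, Set.forall_mem_range.2 hB⟩
    · intro a b
      refine (hw.logConcave _ _ s t hs ht hst).trans_eq ?_
      congr 1
      rw [map_add, map_smul, map_smul, smul_add, smul_add, add_smul, smul_smul, smul_smul]
      abel

end IsLogConcaveWeight

/-- A bounded planar set all of whose triangles are nearly flat lies in a thin strip. -/
theorem exists_thin_strip {X : Set (ℝ × ℝ)} {ε r M : ℝ} (hε : 0 < ε) (hr : 11 * ε ≤ r)
    (hM : ∀ A ∈ X, ∀ B ∈ X, (B.1 - A.1) ^ 2 + (B.2 - A.2) ^ 2 ≤ M)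
    (hflat : ∀ A ∈ X, ∀ B ∈ X, ∀ Z ∈ X, ∃ c s : ℝ, c ^ 2 + s ^ 2 = 1 ∧
      |c * (B.1 - A.1) + s * (B.2 - A.2)| ≤ 3 * ε ∧
      |c * (Z.1 - A.1) + s * (Z.2 - A.2)| ≤ 3 * ε) :
    ∃ c s s₀ : ℝ, c ^ 2 + s ^ 2 = 1 ∧ ∀ Z ∈ X, |c * Z.1 + s * Z.2 - s₀| ≤ r := by
  have hr0 : 0 < r := by linarith
  rcases X.eq_empty_or_nonempty with h | ⟨A₀, hA₀⟩
  · exact ⟨1, 0, 0, by norm_num, by simp [h]⟩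
  set T : Set ℝ := {t | ∃ A ∈ X, ∃ B ∈ X, t = (B.1 - A.1) ^ 2 + (B.2 - A.2) ^ 2} with hT
  have hTb : BddAbove T := ⟨M, by rintro t ⟨A, hA, B, hB, rfl⟩; exact hM A hA B hB⟩
  have hTn : T.Nonempty := ⟨_, A₀, hA₀, A₀, hA₀, rfl⟩
  have hle : ∀ A ∈ X, ∀ B ∈ X, (B.1 - A.1) ^ 2 + (B.2 - A.2) ^ 2 ≤ sSup T := fun A hA B hB =>
    le_csSup hTb ⟨A, hA, B, hB, rfl⟩
  rcases le_or_gt (sSup T) (r ^ 2) with hD | hD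
  · refine ⟨1, 0, A₀.1, by norm_num, fun Z hZ => ?_⟩
    apply abs_le_of_sq_le_sq _ hr0.le
    nlinarith [hle A₀ hA₀ Z hZ, sq_nonneg (Z.2 - A₀.2)]
  obtain ⟨K, ⟨A, hA, B, hB, hK⟩, hKr⟩ := exists_lt_of_lt_csSup hTn
    (max_lt hD (show sSup T / 4 < sSup T by nlinarith))
  have hK1 := (le_max_left _ _).trans_lt hKr
  have hK2 := (le_max_right _ _).trans_lt hKr
  have hK0 : 0 < K := by nlinarith
  have hsK : 0 < √K := Real.sqrt_pos.2 hK0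
  have hsq : √K ^ 2 = K := Real.sq_sqrt hK0.le
  set x := B.1 - A.1 with hx
  set y := B.2 - A.2 with hy
  refine ⟨-y / √K, x / √K, -y / √K * A.1 + x / √K * A.2, ?_, fun Z hZ => ?_⟩
  · rw [div_pow, div_pow, ← add_div, hsq, div_eq_one_iff_eq hK0.ne', hK]; ring
  obtain ⟨c, s, hcs, h1, h2⟩ := hflat A hA B hB Z hZ
  set z1 := Z.1 - A.1 with hz1
  set z2 := Z.2 - A.2 with hz2
  have hZ2 : z1 ^ 2 + z2 ^ 2 ≤ 4 * K := by
    have := hle A hA Z hZ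
    linarith
  rw [show -y / √K * Z.1 + x / √K * Z.2 - (-y / √K * A.1 + x / √K * A.2)
    = (-y * z1 + x * z2) / √K by rw [hz1, hz2]; ring, abs_div, abs_of_pos hsK, div_le_iff₀ hsK]
  by_contra hcon
  push Not at hcon
  set H := -y * z1 + x * z2 with hH
  set U1 := c * x + s * y with hU1
  set U2 := -c * y + s * x with hU2
  have hU : U1 ^ 2 + U2 ^ 2 = K := by
    rw [hU1, hU2, hK]; linear_combination (x ^ 2 + y ^ 2) * hcs
  have hid : (c * z1 + s * z2) * K = U1 * (x * z1 + y * z2) + U2 * H := by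
    rw [hU1, hU2, hH, hK]; ring
  have hPp : |x * z1 + y * z2| ≤ 2 * K := by
    apply abs_le_of_sq_le_sq _ (by positivity)
    have e1 : (x * z1 + y * z2) ^ 2 = K * (z1 ^ 2 + z2 ^ 2) - (x * z2 - y * z1) ^ 2 := by
      rw [hK]; ring
    have e2 := mul_le_mul_of_nonneg_left hZ2 hK0.le
    rw [e1]
    linarith [sq_nonneg (x * z2 - y * z1)]
  have hUH : |U2 * H| ≤ 9 * ε * K := by
    have h3 : U2 * H = (c * z1 + s * z2) * K - U1 * (x * z1 + y * z2) := by linarith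
    rw [h3]
    refine (abs_sub _ _).trans ?_
    rw [abs_mul, abs_mul, abs_of_pos hK0]
    have := mul_le_mul h1 hPp (abs_nonneg _) (by positivity)
    have := mul_le_mul_of_nonneg_right h2 hK0.le
    linarith
  have hH2 : r ^ 2 * K ≤ H ^ 2 := by
    have := pow_le_pow_left₀ (by positivity) hcon.le 2
    rwa [mul_pow, hsq, sq_abs] at this
  have h4 : (U2 * H) ^ 2 ≤ (9 * ε * K) ^ 2 := sq_le_sq' (abs_le.1 hUH).1 (abs_le.1 hUH).2
  have h5 : U2 ^ 2 * r ^ 2 * K ≤ 81 * ε ^ 2 * K * K := by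
    have := mul_le_mul_of_nonneg_left hH2 (sq_nonneg U2)
    linarith
  have h6 : U2 ^ 2 * r ^ 2 ≤ 81 * ε ^ 2 * K := le_of_mul_le_mul_right h5 hK0
  have h7 : U1 ^ 2 ≤ (3 * ε) ^ 2 := sq_le_sq' (abs_le.1 h1).1 (abs_le.1 h1).2
  have h8 : U1 ^ 2 * r ^ 2 ≤ 9 * ε ^ 2 * K := by
    have := mul_le_mul h7 hK1.le (sq_nonneg r) (by positivity)
    linarith
  have h9 : K * r ^ 2 ≤ K * (90 * ε ^ 2) := by
    have : K * r ^ 2 = U1 ^ 2 * r ^ 2 + U2 ^ 2 * r ^ 2 := by rw [← hU]; ring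
    linarith
  have h10 := le_of_mul_le_mul_left h9 hK0
  have h11 := pow_le_pow_left₀ (by positivity) hr 2
  have h12 := pow_pos hε 2
  linarith

namespace IsLogConcaveWeight

variable {E : Type*} [NormedAddCommGroup E] [InnerProductSpace ℝ E] [MeasurableSpace E]
  {d : ℝ} {w : E → ℝ}

theorem indicator (hw : IsLogConcaveWeight d w) {H : Set E} (hH : Convex ℝ H)
    (hHm : MeasurableSet H) : IsLogConcaveWeight d (H.indicator w) where
  nonneg := Set.indicator_nonneg fun x _ => hw.nonneg x
  measurable := hw.measurable.indicator hHm
  bounded := by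
    obtain ⟨B, hB⟩ := hw.bounded
    exact ⟨B, fun x => (Set.indicator_le_self' (fun x _ => hw.nonneg x) x).trans (hB x)⟩
  dist_le x y hx hy := hw.dist_le x y (fun h => hx (by simp [Set.indicator, h]))
    (fun h => hy (by simp [Set.indicator, h]))
  logConcave x y s t hs ht hst := by
    by_cases hx : x ∈ H
    · by_cases hy : y ∈ H
      · rw [Set.indicator_of_mem hx, Set.indicator_of_mem hy,
          Set.indicator_of_mem (hH hx hy hs.le ht.le hst)]
        exact hw.logConcave x y s t hs ht hst
      · rw [Set.indicator_of_notMem hy, Real.zero_rpow ht.ne', mul_zero]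
        exact Set.indicator_nonneg (fun x _ => hw.nonneg x) _
    · rw [Set.indicator_of_notMem hx, Real.zero_rpow hs.ne', zero_mul]
      exact Set.indicator_nonneg (fun x _ => hw.nonneg x) _

variable [FiniteDimensional ℝ E] [BorelSpace E]

theorem _root_.measure_inner_sub_eq_zero {μ : Measure E} [μ.IsAddHaarMeasure] {θ : E}
    (hθ : θ ≠ 0) (x : E) : μ {y | ⟪θ, y - x⟫ = 0} = 0 := by
  have : {y | ⟪θ, y - x⟫ = 0} = (AffineSubspace.mk' x (ℝ ∙ θ)ᗮ : Set E) := by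
    ext y
    simp [AffineSubspace.mem_mk', Submodule.mem_orthogonal_singleton_iff_inner_right]
  rw [this]
  apply Measure.addHaar_affineSubspace
  intro h
  have h1 : x + θ ∈ (AffineSubspace.mk' x (ℝ ∙ θ)ᗮ) := h ▸ AffineSubspace.mem_top _ _ _
  simp [AffineSubspace.mem_mk', Submodule.mem_orthogonal_singleton_iff_inner_right, hθ] at h1

/-- A half-space through `x`, with normal in the plane spanned by `e₁` and `e₂`, bisecting `f`
and carrying a positive part of `g`. -/
theorem exists_bisection {μ : Measure E} [μ.IsAddHaarMeasure] (hw : IsLogConcaveWeight d w)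
    {f g : E → ℝ} (hf : Continuous f) (hg : Continuous g) (hf0 : ∫ y, w y * f y ∂μ = 0)
    (hg0 : 0 < ∫ y, w y * g y ∂μ) {e₁ e₂ : E} (he₁ : ‖e₁‖ = 1) (he₂ : ‖e₂‖ = 1)
    (he : ⟪e₁, e₂⟫ = 0) (x : E) :
    ∃ w' : E → ℝ, IsLogConcaveWeight d w' ∧ (∀ y, w' y ≤ w y) ∧ ∫ y, w' y * f y ∂μ = 0 ∧
      0 < ∫ y, w' y * g y ∂μ ∧ ∃ c s : ℝ, c ^ 2 + s ^ 2 = 1 ∧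
        ∀ y, w' y ≠ 0 → 0 ≤ ⟪c • e₁ + s • e₂, y - x⟫ := by
  set θ : ℝ → E := fun α => Real.cos α • e₁ + Real.sin α • e₂ with hθ
  have hθc : Continuous θ := by rw [hθ]; fun_prop
  have hθ0 : ∀ α, θ α ≠ 0 := by
    intro α h
    have h1 : ⟪e₁, θ α⟫ = Real.cos α := by
      simp [hθ, inner_add_right, inner_smul_right, he, he₁]
    have h2 : ⟪e₂, θ α⟫ = Real.sin α := by
      simp [hθ, inner_add_right, inner_smul_right, real_inner_comm, he, he₂]
    rw [h, inner_zero_right] at h1 h2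
    have := Real.sin_sq_add_cos_sq α
    rw [← h1, ← h2] at this
    norm_num at this
  have hθπ : ∀ α, θ (α + π) = -θ α := by
    intro α; simp [hθ, Real.cos_add_pi, Real.sin_add_pi]; abel
  set Hs : ℝ → Set E := fun α => {y | 0 < ⟪θ α, y - x⟫} with hHs
  have hHm : ∀ α, MeasurableSet (Hs α) := fun α =>
    measurableSet_lt measurable_const (by fun_prop : Continuous fun y => ⟪θ α, y - x⟫).measurable
  have hHc : ∀ α, Convex ℝ (Hs α) := by
    intro α y hy z hz a b ha hb hab
    have h1 : a • y + b • z - x = a • (y - x) + b • (z - x) := by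
      rw [smul_sub, smul_sub]
      nth_rewrite 1 [← one_smul ℝ x]
      rw [← hab, add_smul]; abel
    have hy : 0 < ⟪θ α, y - x⟫ := hy
    have hz : 0 < ⟪θ α, z - x⟫ := hz
    change 0 < ⟪θ α, a • y + b • z - x⟫
    rw [h1, inner_add_right, inner_smul_right, inner_smul_right]
    rcases ha.eq_or_lt with h | h
    · have : b = 1 := by linarith
      simp [← h, this, hz]
    · have := mul_pos h hy
      have := mul_nonneg hb hz.le
      linarith
  have hsplit : ∀ F : E → ℝ, Continuous F → ∀ α, (∫ y, (Hs α).indicator w y * F y ∂μ)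
      + (∫ y, (Hs (α + π)).indicator w y * F y ∂μ) = ∫ y, w y * F y ∂μ := by
    intro F hF α
    rw [← integral_add ((hw.indicator (hHc _) (hHm _)).integrable_mul hF)
      ((hw.indicator (hHc _) (hHm _)).integrable_mul hF)]
    refine integral_congr_ae ?_
    have hnull : ∀ᵐ y ∂μ, ⟪θ α, y - x⟫ ≠ 0 := by
      rw [ae_iff]; simpa using measure_inner_sub_eq_zero (hθ0 α) x
    filter_upwards [hnull] with y hy
    rcases lt_or_gt_of_ne hy with h | h
    · have h1 : y ∉ Hs α := by simp [hHs, h.le]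
      have h2 : y ∈ Hs (α + π) := by simp [hHs, hθπ, h]
      simp [h1, h2]
    · have h1 : y ∈ Hs α := by simp [hHs, h]
      have h2 : y ∉ Hs (α + π) := by simp [hHs, hθπ, h.le]
      simp [h1, h2]
  set I : ℝ → ℝ := fun α => ∫ y, (Hs α).indicator w y * f y ∂μ with hI
  have hIc : Continuous I := by
    rw [continuous_iff_continuousAt]
    intro α
    refine continuousAt_of_dominated (bound := fun y => ‖w y * f y‖) ?_ ?_
      (hw.integrable_mul hf).norm ?_
    · exact Eventually.of_forall fun β =>
        ((hw.measurable.indicator (hHm β)).mul hf.measurable).aestronglyMeasurable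
    · refine Eventually.of_forall fun β => ae_of_all _ fun y => ?_
      by_cases hy : y ∈ Hs β <;> simp [hy]
      positivity
    · have hnull : ∀ᵐ y ∂μ, ⟪θ α, y - x⟫ ≠ 0 := by
        rw [ae_iff]; simpa using measure_inner_sub_eq_zero (hθ0 α) x
      filter_upwards [hnull] with y hy
      have hcy : Continuous fun β => ⟪θ β, y - x⟫ := by fun_prop
      rcases lt_or_gt_of_ne hy with h | h
      · have h1 := hcy.continuousAt.eventually_lt (continuousAt_const (y := (0:ℝ))) h
        refine (continuousAt_const (y := (0:ℝ))).congr ?_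
        filter_upwards [h1] with β hβ
        have : y ∉ Hs β := by simp [hHs, hβ.le]
        simp [this]
      · have h1 := (continuousAt_const (y := (0:ℝ))).eventually_lt hcy.continuousAt h
        refine (continuousAt_const (y := w y * f y)).congr ?_
        filter_upwards [h1] with β hβ
        have : y ∈ Hs β := by simp [hHs, hβ]
        simp [this]
  obtain ⟨α, hα⟩ : ∃ α, I α = 0 := by
    have h1 := hsplit f hf 0
    rw [hf0] at h1
    have hv := intermediate_value_univ 0 (0 + π) hIc
    have hv' := intermediate_value_univ (0 + π) 0 hIc
    rcases le_total (I 0) 0 with h | h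
    · exact hv ⟨h, by simp only [hI] at h ⊢; linarith⟩
    · exact hv' ⟨by simp only [hI] at h ⊢; linarith, h⟩
  have hα' : I (α + π) = 0 := by
    have := hsplit f hf α
    simp only [hI] at hα ⊢
    linarith
  have key : ∀ β, I β = 0 → 0 < ∫ y, (Hs β).indicator w y * g y ∂μ →
      ∃ w' : E → ℝ, IsLogConcaveWeight d w' ∧ (∀ y, w' y ≤ w y) ∧ ∫ y, w' y * f y ∂μ = 0 ∧
      0 < ∫ y, w' y * g y ∂μ ∧ ∃ c s : ℝ, c ^ 2 + s ^ 2 = 1 ∧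
        ∀ y, w' y ≠ 0 → 0 ≤ ⟪c • e₁ + s • e₂, y - x⟫ := by
    intro β h1 h2
    refine ⟨(Hs β).indicator w, hw.indicator (hHc _) (hHm _),
      Set.indicator_le_self' (fun x _ => hw.nonneg x), h1, h2, Real.cos β, Real.sin β,
      Real.cos_sq_add_sin_sq β, fun y hy => ?_⟩
    have : y ∈ Hs β := Set.mem_of_indicator_ne_zero hy
    exact le_of_lt this
  rcases lt_or_ge 0 (∫ y, (Hs α).indicator w y * g y ∂μ) with h | h
  · exact key α hα h
  · refine key (α + π) hα' ?_
    have := hsplit g hg α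
    linarith

end IsLogConcaveWeight

namespace IsLogConcaveWeight

variable {E : Type*} [NormedAddCommGroup E] [InnerProductSpace ℝ E] [MeasurableSpace E]
  {d : ℝ} {w : E → ℝ} [FiniteDimensional ℝ E] [BorelSpace E]

theorem exists_bisection_finset {μ : Measure E} [μ.IsAddHaarMeasure]
    (hw : IsLogConcaveWeight d w)
    {f g : E → ℝ} (hf : Continuous f) (hg : Continuous g) (hf0 : ∫ y, w y * f y ∂μ = 0)
    (hg0 : 0 < ∫ y, w y * g y ∂μ) {e₁ e₂ : E} (he₁ : ‖e₁‖ = 1) (he₂ : ‖e₂‖ = 1)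
    (he : ⟪e₁, e₂⟫ = 0) (N : Finset E) :
    ∃ w' : E → ℝ, IsLogConcaveWeight d w' ∧ (∀ y, w' y ≤ w y) ∧ ∫ y, w' y * f y ∂μ = 0 ∧
      0 < ∫ y, w' y * g y ∂μ ∧ ∀ x ∈ N, ∃ c s : ℝ, c ^ 2 + s ^ 2 = 1 ∧
        ∀ y, w' y ≠ 0 → 0 ≤ ⟪c • e₁ + s • e₂, y - x⟫ := by
  classical
  induction N using Finset.induction_on with
  | empty => exact ⟨w, hw, fun _ => le_rfl, hf0, hg0, by simp⟩
  | insert x N _ ih =>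
    obtain ⟨w₁, h1, h2, h3, h4, h5⟩ := ih
    obtain ⟨w₂, k1, k2, k3, k4, k5⟩ := h1.exists_bisection hf hg h3 h4 he₁ he₂ he x
    refine ⟨w₂, k1, fun y => (k2 y).trans (h2 y), k3, k4, fun z hz => ?_⟩
    rcases Finset.mem_insert.1 hz with rfl | hz
    · exact k5
    · obtain ⟨c, s, hcs, h⟩ := h5 z hz
      refine ⟨c, s, hcs, fun y hy => h y fun hy1 => hy ?_⟩
      exact le_antisymm ((k2 y).trans hy1.le) (k1.nonneg y)

/-- Localization: bisecting `f` repeatedly, one reaches a weight supported in a thin slab. -/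
theorem exists_thin_localization {μ : Measure E} [μ.IsAddHaarMeasure]
    (hw : IsLogConcaveWeight d w)
    {f g : E → ℝ} (hf : Continuous f) (hg : Continuous g) (hf0 : ∫ y, w y * f y ∂μ = 0)
    (hg0 : 0 < ∫ y, w y * g y ∂μ) {e₁ e₂ : E} (he₁ : ‖e₁‖ = 1) (he₂ : ‖e₂‖ = 1)
    (he : ⟪e₁, e₂⟫ = 0) {r : ℝ} (hr : 0 < r) :
    ∃ w' : E → ℝ, IsLogConcaveWeight d w' ∧ ∫ y, w' y * f y ∂μ = 0 ∧
      0 < ∫ y, w' y * g y ∂μ ∧ ∃ θ : E, ‖θ‖ = 1 ∧ ∃ s₀ : ℝ, ∀ y, w' y ≠ 0 → |⟪θ, y⟫ - s₀| ≤ r := by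
  obtain ⟨x₀, hx₀⟩ : ∃ x, w x ≠ 0 := by
    by_contra h; push Not at h; simp [h] at hg0
  set ε := r / 11 with hε
  have hε0 : 0 < ε := by positivity
  obtain ⟨t, -, htf, ht⟩ := (isCompact_closedBall x₀ d).finite_cover_balls hε0
  obtain ⟨w', h1, h2, h3, h4, h5⟩ :=
    hw.exists_bisection_finset hf hg hf0 hg0 he₁ he₂ he htf.toFinset
  refine ⟨w', h1, h3, h4, ?_⟩
  have hball : ∀ y, w' y ≠ 0 → dist y x₀ ≤ d := fun y hy => hw.dist_le y x₀
    (fun h => hy (le_antisymm ((h2 y).trans h.le) (h1.nonneg y))) hx₀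
  have hnorm : ∀ c s : ℝ, c ^ 2 + s ^ 2 = 1 → ‖c • e₁ + s • e₂‖ = 1 := by
    intro c s h
    have h0 : ⟪c • e₁, s • e₂⟫ = 0 := by simp [inner_smul_left, inner_smul_right, he]
    have := norm_add_sq_eq_norm_sq_add_norm_sq_of_inner_eq_zero _ _ h0
    rw [norm_smul, norm_smul, he₁, he₂, mul_one, mul_one, Real.norm_eq_abs, Real.norm_eq_abs,
      abs_mul_abs_self, abs_mul_abs_self] at this
    have h1 : ‖c • e₁ + s • e₂‖ ^ 2 = 1 ^ 2 := by nlinarith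
    exact (sq_eq_sq₀ (norm_nonneg _) zero_le_one).1 h1
  have hin : ∀ (c s : ℝ) (y : E), ⟪c • e₁ + s • e₂, y⟫ = c * ⟪e₁, y⟫ + s * ⟪e₂, y⟫ := by
    intro c s y; simp [inner_add_left, inner_smul_left]
  suffices H : ∃ c s s₀ : ℝ, c ^ 2 + s ^ 2 = 1 ∧
      ∀ Z ∈ (fun y => (⟪e₁, y⟫, ⟪e₂, y⟫)) '' {y | w' y ≠ 0}, |c * Z.1 + s * Z.2 - s₀| ≤ r by
    obtain ⟨c, s, s₀, hcs, hst⟩ := H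
    exact ⟨c • e₁ + s • e₂, hnorm c s hcs, s₀, fun y hy => by
      rw [hin]; exact hst _ ⟨y, hy, rfl⟩⟩
  refine exists_thin_strip (ε := ε) (M := 2 * d ^ 2) hε0 (by rw [hε]; linarith) ?_ ?_
  · rintro _ ⟨A, hA, rfl⟩ _ ⟨B, hB, rfl⟩
    have hd := h1.dist_le B A hB hA
    rw [dist_eq_norm] at hd
    simp only [← inner_sub_right]
    have k1 := abs_real_inner_le_norm e₁ (B - A)
    have k2 := abs_real_inner_le_norm e₂ (B - A)
    rw [he₁, one_mul] at k1
    rw [he₂, one_mul] at k2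
    have k1' := sq_le_sq' (abs_le.1 (k1.trans hd)).1 (abs_le.1 (k1.trans hd)).2
    have k2' := sq_le_sq' (abs_le.1 (k2.trans hd)).1 (abs_le.1 (k2.trans hd)).2
    linarith
  · rintro _ ⟨A, hA, rfl⟩ _ ⟨B, hB, rfl⟩ _ ⟨Z, hZ, rfl⟩
    set G := (1 / 3 : ℝ) • (A + B + Z) with hG
    have hGb : G ∈ Metric.closedBall x₀ d := by
      have e : G - x₀ = (1 / 3 : ℝ) • ((A - x₀) + (B - x₀) + (Z - x₀)) := by
        rw [hG]; module
      rw [Metric.mem_closedBall, dist_eq_norm, e, norm_smul]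
      have a1 := hball A hA
      have a2 := hball B hB
      have a3 := hball Z hZ
      rw [dist_eq_norm] at a1 a2 a3
      have := norm_add₃_le (a := A - x₀) (b := B - x₀) (c := Z - x₀)
      norm_num
      linarith
    obtain ⟨x, hx, hGx⟩ := Set.mem_iUnion₂.1 (ht hGb)
    obtain ⟨c, s, hcs, h⟩ := h5 x (htf.mem_toFinset.2 hx)
    refine ⟨c, s, hcs, ?_⟩
    have a1 := h A hA
    have a2 := h B hB
    have a3 := h Z hZ
    have a4 : ⟪c • e₁ + s • e₂, G - x⟫ ≤ ε := by
      refine (le_abs_self _).trans ((abs_real_inner_le_norm _ _).trans ?_)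
      rw [hnorm c s hcs, one_mul, ← dist_eq_norm]
      exact (Metric.mem_ball.1 hGx).le
    have a5 : ⟪c • e₁ + s • e₂, G⟫ = (⟪c • e₁ + s • e₂, A⟫ + ⟪c • e₁ + s • e₂, B⟫
        + ⟪c • e₁ + s • e₂, Z⟫) / 3 := by
      rw [hG, inner_smul_right, inner_add_right, inner_add_right]; ring
    rw [inner_sub_right] at a1 a2 a3 a4
    rw [a5] at a4
    simp only [hin] at a1 a2 a3 a4
    constructor <;> rw [abs_le] <;> constructor <;> linarith

end IsLogConcaveWeight

/-- Fubini for weights along a unit vector. -/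
theorem exists_orthogonal_splitting_integral {n : ℕ} (θ : EuclideanSpace ℝ (Fin (n + 1)))
    (hθ : ‖θ‖ = 1) :
    ∃ (ι : EuclideanSpace ℝ (Fin n) →ₗᵢ[ℝ] EuclideanSpace ℝ (Fin (n + 1)))
      (R : EuclideanSpace ℝ (Fin (n + 1)) → EuclideanSpace ℝ (Fin n)), Continuous R ∧
      (∀ y, ι (R y) + ⟪θ, y⟫ • θ = y) ∧
      ∀ {d : ℝ} {w : EuclideanSpace ℝ (Fin (n + 1)) → ℝ}, IsLogConcaveWeight d w →
        IsLogConcaveWeight d (fun z => ∫ s : ℝ, w (ι z + s • θ)) ∧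
        ∀ G : EuclideanSpace ℝ (Fin n) → ℝ, Continuous G →
          ∫ z, (∫ s : ℝ, w (ι z + s • θ)) * G z = ∫ y, w y * G (R y) := by
  obtain ⟨ι, h1, h2, h3, h4⟩ := exists_orthogonal_splitting θ hθ
  set R := ContinuousLinearMap.adjoint ι.toContinuousLinearMap with hR
  have hRι : ∀ z (s : ℝ), R (ι z + s • θ) = z := by
    intro z s
    refine ext_inner_right ℝ fun x => ?_
    rw [hR, ContinuousLinearMap.adjoint_inner_left]
    simp [inner_add_left, inner_smul_left, h1]
  refine ⟨ι, R, R.continuous, fun y => ?_, fun {d w} hw => ⟨hw.marginal ι hθ h1 h2.measurable,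
    fun G hG => ?_⟩⟩
  · obtain ⟨⟨z, s⟩, rfl⟩ := h4 y
    simp only [hRι]
    simp [inner_add_right, inner_smul_right, h1, hθ]
  · have hi := (h2.integrable_comp_emb h3).2 (hw.integrable_mul (μ := volume)
      (hG.comp R.continuous))
    rw [← h2.integral_comp h3 (fun y => w y * G (R y))]
    simp only [hRι, Function.comp_def] at hi ⊢
    rw [Measure.volume_eq_prod] at hi ⊢
    rw [integral_prod _ hi]
    simp only [integral_mul_const]

theorem HasCompactSupport.exists_forall_dist_le {E : Type*} [NormedAddCommGroup E]
    [NormedSpace ℝ E] {h : E → ℝ} {c : ℝ} (hc : Continuous h)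
    (hs : HasCompactSupport fun x => h x - c) {ε : ℝ} (hε : 0 < ε) :
    ∃ r > 0, ∀ x y, dist x y ≤ r → |h x - h y| ≤ ε := by
  have hu : UniformContinuous fun x => h x - c :=
    hs.uniformContinuous_of_continuous (hc.sub continuous_const)
  obtain ⟨r, hr, h⟩ := Metric.uniformContinuous_iff.1 hu ε hε
  refine ⟨r / 2, by positivity, fun x y hxy => ?_⟩
  have := h (lt_of_le_of_lt hxy (half_lt_self hr))
  rw [Real.dist_eq, sub_sub_sub_cancel_right] at this
  exact this.le

theorem continuous_abs_rpow_mul_self {p : ℝ} (hp : 2 ≤ p) :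
    Continuous fun x : ℝ => |x| ^ (p - 2) * x := by
  have : 0 ≤ p - 2 := by linarith
  fun_prop (disch := exact this)

/-- Existence of the weighted `p`-mean of a bounded continuous function. -/
theorem IsLogConcaveWeight.exists_mean {E : Type*} [NormedAddCommGroup E] [InnerProductSpace ℝ E]
    [FiniteDimensional ℝ E] [MeasurableSpace E] [BorelSpace E] {μ : Measure E}
    [IsFiniteMeasureOnCompacts μ] {d p : ℝ} {w : E → ℝ} (hw : IsLogConcaveWeight d w)
    (hp : 2 ≤ p) {v : E → ℝ} (hv : Continuous v) {B : ℝ} (hB : ∀ x, |v x| ≤ B) :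
    ∃ k, |k| ≤ B ∧ ∫ x, w x * (|v x - k| ^ (p - 2) * (v x - k)) ∂μ = 0 := by
  have hφ := continuous_abs_rpow_mul_self hp
  have hB0 : 0 ≤ B := (abs_nonneg _).trans (hB 0)
  have hI : Continuous fun k => ∫ x, w x * (|v x - k| ^ (p - 2) * (v x - k)) ∂μ := by
    rw [continuous_iff_continuousAt]
    intro k
    refine continuousAt_of_dominated
      (bound := fun x => w x * ((B + (|k| + 1)) ^ (p - 2) * (B + (|k| + 1)))) ?_ ?_
      (hw.integrable.mul_const _) ?_
    · exact Eventually.of_forall fun c => (hw.measurable.mul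
        (hφ.comp (hv.sub continuous_const)).measurable).aestronglyMeasurable
    · filter_upwards [Metric.ball_mem_nhds k one_pos] with c hc
      refine ae_of_all _ fun x => ?_
      have h1 : |v x - c| ≤ B + (|k| + 1) := by
        refine (abs_sub _ _).trans (add_le_add (hB x) ?_)
        have := abs_lt.1 (Metric.mem_ball.1 hc)
        have := abs_sub_abs_le_abs_sub c k
        rw [← Real.dist_eq] at this
        have := Metric.mem_ball.1 hc
        linarith
      rw [norm_mul, Real.norm_of_nonneg (hw.nonneg x), norm_mul, Real.norm_eq_abs, Real.norm_eq_abs,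
        abs_of_nonneg (by positivity : 0 ≤ |v x - c| ^ (p - 2))]
      have := hw.nonneg x
      have h2 : |v x - c| ^ (p - 2) ≤ (B + (|k| + 1)) ^ (p - 2) :=
        Real.rpow_le_rpow (abs_nonneg _) h1 (by linarith)
      gcongr
    · exact ae_of_all _ fun x => (continuous_const.mul
        (hφ.comp (continuous_const.sub continuous_id))).continuousAt
  have hIB : ∫ x, w x * (|v x - B| ^ (p - 2) * (v x - B)) ∂μ ≤ 0 :=
    integral_nonpos fun x => mul_nonpos_of_nonneg_of_nonpos (hw.nonneg x)
      (mul_nonpos_of_nonneg_of_nonpos (by positivity) (by linarith [(abs_le.1 (hB x)).2]))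
  have hIB' : 0 ≤ ∫ x, w x * (|v x - -B| ^ (p - 2) * (v x - -B)) ∂μ :=
    integral_nonneg fun x => mul_nonneg (hw.nonneg x)
      (mul_nonneg (by positivity) (by linarith [(abs_le.1 (hB x)).1]))
  obtain ⟨k, hk, hk0⟩ := intermediate_value_Icc' (by linarith : -B ≤ B) hI.continuousOn ⟨hIB, hIB'⟩
  exact ⟨k, abs_le.2 hk, hk0⟩

theorem IsLogConcaveWeight.integral_mul_sub_sub {n : ℕ} {d : ℝ}
    {w : EuclideanSpace ℝ (Fin n) → ℝ} (hw : IsLogConcaveWeight d w)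
    {A D : EuclideanSpace ℝ (Fin n) → ℝ} (hA : Continuous A) (hD : Continuous D) (a b c : ℝ) :
    ∫ x, w x * (a * A x - b * D x - c) =
      a * (∫ x, w x * A x) - b * (∫ x, w x * D x) - c * ∫ x, w x := by
  have hi : Integrable fun x => a * (w x * A x) - b * (w x * D x) :=
    ((hw.integrable_mul hA).const_mul _).sub ((hw.integrable_mul hD).const_mul _)
  have : ∀ x, w x * (a * A x - b * D x - c) =
      a * (w x * A x) - b * (w x * D x) - c * w x := fun x => by ring
  simp only [this]
  rw [integral_sub hi (hw.integrable.const_mul _), integral_sub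
    ((hw.integrable_mul hA).const_mul _) ((hw.integrable_mul hD).const_mul _),
    integral_const_mul, integral_const_mul, integral_const_mul]

theorem WeightedPoincare.succ {n : ℕ} (hn : 1 ≤ n) {p κ d : ℝ} (hp : 2 ≤ p) (hκ : 0 < κ)
    (h : WeightedPoincare (EuclideanSpace ℝ (Fin n)) p κ d) :
    WeightedPoincare (EuclideanSpace ℝ (Fin (n + 1))) p κ d := by
  intro w hw v hv hvs δ hδ
  have hp0 : 0 ≤ p := by linarith
  have hvc := hv.continuous
  have hDc : Continuous (fderiv ℝ v) := hv.continuous_fderiv one_ne_zero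
  have hφ := continuous_abs_rpow_mul_self hp
  obtain ⟨B, hB⟩ := hvc.bounded_above_of_compact_support hvs
  have hB0 : 0 ≤ B := (norm_nonneg _).trans (hB 0)
  obtain ⟨k₀, hk₀, hmean⟩ := hw.exists_mean (μ := volume) hp hvc hB
  refine ⟨k₀, ?_⟩
  by_contra hcon
  push Not at hcon
  have hc1 : Continuous fun x => |v x - k₀| ^ p := by fun_prop (disch := exact hp0)
  have hc2 : Continuous fun x => ‖fderiv ℝ v x‖ ^ p := by fun_prop (disch := exact hp0)
  have hc3 : Continuous fun x => |v x - k₀| ^ (p - 2) * (v x - k₀) :=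
    hφ.comp (hvc.sub continuous_const)
  set m₀ := ∫ x, w x with hm₀
  have hm₀0 : 0 ≤ m₀ := integral_nonneg hw.nonneg
  set δ' := δ / (m₀ + 1) with hδ'
  have hδ'0 : 0 < δ' := by positivity
  have hδ'm : δ' * m₀ ≤ δ := by
    rw [hδ', div_mul_eq_mul_div, div_le_iff₀ (by positivity)]; nlinarith
  have hgpos : 0 < ∫ x, w x * (κ * |v x - k₀| ^ p - ‖fderiv ℝ v x‖ ^ p - δ') := by
    have h := hw.integral_mul_sub_sub hc1 hc2 κ 1 δ'
    simp only [one_mul] at h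
    rw [h]
    linarith
  -- uniform continuity scale
  set C := κ * (1 + 2 * p * B) + 1 with hC
  have hC0 : 0 < C := by positivity
  set ε := δ' / 2 / C with hε
  have hε0 : 0 < ε := by positivity
  have hs1 : HasCompactSupport fun x => |v x - k₀| ^ p - |0 - k₀| ^ p :=
    hvs.comp_left (g := fun t => |t - k₀| ^ p - |0 - k₀| ^ p) (by simp)
  have hs2 : HasCompactSupport fun x => ‖fderiv ℝ v x‖ ^ p - 0 :=
    (hvs.fderiv ℝ).comp_left (g := fun t => ‖t‖ ^ p - 0)
      (by simp [Real.zero_rpow (by linarith : p ≠ 0)])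
  have hs3 : HasCompactSupport fun x => |v x - k₀| ^ (p - 2) * (v x - k₀)
      - |0 - k₀| ^ (p - 2) * (0 - k₀) :=
    hvs.comp_left (g := fun t => |t - k₀| ^ (p - 2) * (t - k₀)
      - |0 - k₀| ^ (p - 2) * (0 - k₀)) (by simp)
  obtain ⟨r1, hr1, hu1⟩ := HasCompactSupport.exists_forall_dist_le hc1 hs1 hε0
  obtain ⟨r2, hr2, hu2⟩ := HasCompactSupport.exists_forall_dist_le hc2 hs2 hε0
  obtain ⟨r3, hr3, hu3⟩ := HasCompactSupport.exists_forall_dist_le hc3 hs3 hε0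
  set r := min r1 (min r2 r3) with hr
  have hr0 : 0 < r := lt_min hr1 (lt_min hr2 hr3)
  -- localization
  have hn2 : (⟨0, by omega⟩ : Fin (n + 1)) ≠ ⟨1, by omega⟩ := by simp
  obtain ⟨w', hw', hf', hg', θ, hθ, s₀, hthin⟩ := hw.exists_thin_localization hc3
    (g := fun x => κ * |v x - k₀| ^ p - ‖fderiv ℝ v x‖ ^ p - δ')
    (((continuous_const.mul hc1).sub hc2).sub continuous_const) hmean hgpos
    (e₁ := EuclideanSpace.single ⟨0, by omega⟩ (1:ℝ))
    (e₂ := EuclideanSpace.single ⟨1, by omega⟩ (1:ℝ)) (by simp) (by simp)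
    (by simp [EuclideanSpace.inner_single_left]) hr0
  obtain ⟨ι, R, hRc, hRy, hfub⟩ := exists_orthogonal_splitting_integral θ hθ
  obtain ⟨hw₁, hint⟩ := hfub hw'
  set V : EuclideanSpace ℝ (Fin n) → ℝ := fun z => v (ι z + s₀ • θ) with hV
  have hιd : ContDiff ℝ 1 fun z => ι z + s₀ • θ := ι.contDiff.add contDiff_const
  have hVc : ContDiff ℝ 1 V := hv.comp hιd
  have hVs : HasCompactSupport V := by
    have hiso : Isometry fun z => ι z + s₀ • θ := fun x y => by
      rw [edist_add_right, ι.edist_map]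
    exact hvs.comp_isClosedEmbedding hiso.isClosedEmbedding
  have hVD : ∀ z, ‖fderiv ℝ V z‖ ≤ ‖fderiv ℝ v (ι z + s₀ • θ)‖ := by
    intro z
    have hd1 : HasFDerivAt (fun z => ι z + s₀ • θ) ι.toContinuousLinearMap z :=
      ι.toContinuousLinearMap.hasFDerivAt.add_const _
    have hd2 := ((hv.differentiable one_ne_zero) (ι z + s₀ • θ)).hasFDerivAt.comp z hd1
    rw [show fderiv ℝ V z = _ from hd2.fderiv]
    refine (ContinuousLinearMap.opNorm_comp_le _ _).trans ?_
    exact mul_le_of_le_one_right (norm_nonneg _) ι.norm_toContinuousLinearMap_le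
  set m := ∫ y, w' y with hm
  have hm0 : 0 < m := by
    refine lt_of_le_of_ne (integral_nonneg hw'.nonneg) fun hm0 => ?_
    have h0 := (integral_eq_zero_iff_of_nonneg hw'.nonneg hw'.integrable).1 hm0.symm
    have : ∫ x, w' x * (κ * |v x - k₀| ^ p - ‖fderiv ℝ v x‖ ^ p - δ') = 0 := by
      rw [← integral_zero (EuclideanSpace ℝ (Fin (n+1))) ℝ]
      refine integral_congr_ae ?_
      filter_upwards [h0] with x hx
      simp only [Pi.zero_apply] at hx
      simp [hx]
    linarith
  obtain ⟨k₁, hk₁⟩ := h _ hw₁ V hVc hVs (δ' / 4 * m) (by positivity)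
  -- clamp the constant
  set k := max (-B) (min k₁ B) with hk
  have hkB : |k| ≤ B := abs_le.2 ⟨le_max_left _ _, max_le (by linarith) (min_le_right _ _)⟩
  have hclamp : ∀ z, |V z - k| ≤ |V z - k₁| := by
    intro z
    have hVB := abs_le.1 (hB (ι z + s₀ • θ))
    change -B ≤ V z ∧ V z ≤ B at hVB
    rcases le_total k₁ B with h1 | h1
    · rw [hk, min_eq_left h1]
      rcases le_total (-B) k₁ with h2 | h2
      · rw [max_eq_right h2]
      · rw [max_eq_left h2, abs_of_nonneg (by linarith), abs_of_nonneg (by linarith)]; linarith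
    · rw [hk, min_eq_right h1, max_eq_right (by linarith), abs_of_nonpos (by linarith),
        abs_of_nonpos (by linarith)]; linarith
  have hVcc := hVc.continuous
  have hVk : Continuous fun z => |V z - k| ^ p := by fun_prop (disch := exact hp0)
  have hVDc : Continuous fun z => ‖fderiv ℝ V z‖ ^ p := by
    have := hVc.continuous_fderiv one_ne_zero
    fun_prop (disch := exact hp0)
  have hk₂ : κ * ∫ y, w' y * |V (R y) - k| ^ p ≤
      (∫ y, w' y * ‖fderiv ℝ V (R y)‖ ^ p) + δ' / 4 * m := by
    rw [← hint _ hVk, ← hint _ hVDc]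
    refine le_trans (mul_le_mul_of_nonneg_left ?_ hκ.le) hk₁
    refine integral_mono (hw₁.integrable_mul hVk)
      (hw₁.integrable_mul (F := fun z => |V z - k₁| ^ p) (by fun_prop (disch := exact hp0)))
      fun z => ?_
    exact mul_le_mul_of_nonneg_left (Real.rpow_le_rpow (abs_nonneg _) (hclamp z) hp0)
      (hw₁.nonneg z)
  have hdist : ∀ y, w' y ≠ 0 → dist (ι (R y) + s₀ • θ) y ≤ r := by
    intro y hy
    nth_rewrite 2 [← hRy y]
    rw [dist_add_left, dist_eq_norm, ← sub_smul, norm_smul, hθ, mul_one, Real.norm_eq_abs,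
      abs_sub_comm]
    exact hthin y hy
  have hup : ∫ y, w' y * ‖fderiv ℝ V (R y)‖ ^ p ≤ (∫ y, w' y * ‖fderiv ℝ v y‖ ^ p) + ε * m := by
    rw [hm, ← integral_const_mul, ← integral_add (hw'.integrable_mul hc2)
      (hw'.integrable.const_mul _)]
    refine integral_mono (hw'.integrable_mul (hVDc.comp hRc))
      ((hw'.integrable_mul hc2).add (hw'.integrable.const_mul _)) fun y => ?_
    by_cases hy : w' y = 0
    · simp [hy]
    have h1 := (abs_le.1 (hu2 _ y ((hdist y hy).trans ((min_le_right _ _).trans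
      (min_le_left _ _))))).2
    have h2 := Real.rpow_le_rpow (norm_nonneg _) (hVD (R y)) hp0
    have h3 := mul_le_mul_of_nonneg_left (show ‖fderiv ℝ V (R y)‖ ^ p ≤ ‖fderiv ℝ v y‖ ^ p + ε by
      linarith) (hw'.nonneg y)
    simp only
    linarith
  have hkk : |k - k₀| ≤ 2 * B := (abs_sub _ _).trans (by linarith)
  have hlow : (∫ y, w' y * |v y - k₀| ^ p) - ε * (1 + 2 * p * B) * m ≤
      ∫ y, w' y * |V (R y) - k| ^ p := by
    have e1 := hw'.integral_mul_sub_sub hc1 hc3 1 (p * (k - k₀)) (ε * (1 + 2 * p * B))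
    rw [hf', mul_zero, sub_zero, one_mul] at e1
    rw [← e1]
    refine integral_mono (hw'.integrable_mul (F := fun y => 1 * |v y - k₀| ^ p
      - p * (k - k₀) * (|v y - k₀| ^ (p - 2) * (v y - k₀)) - ε * (1 + 2 * p * B))
      (((continuous_const.mul hc1).sub (continuous_const.mul hc3)).sub continuous_const)) (hw'.integrable_mul (hVk.comp hRc)) fun y => ?_
    by_cases hy : w' y = 0
    · simp [hy]
    have h1 := (abs_le.1 (hu1 _ y ((hdist y hy).trans (min_le_left _ _)))).1
    have h3 := hu3 _ y ((hdist y hy).trans ((min_le_right _ _).trans (min_le_right _ _)))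
    have h4 := abs_sub_rpow_ge hp (V (R y) - k₀) (k - k₀)
    rw [sub_sub_sub_cancel_right] at h4
    have h5 : (k - k₀) * (|V (R y) - k₀| ^ (p - 2) * (V (R y) - k₀))
        ≤ (k - k₀) * (|v y - k₀| ^ (p - 2) * (v y - k₀)) + 2 * B * ε := by
      have h6 := mul_le_mul hkk h3 (abs_nonneg _) (by positivity)
      rw [← abs_mul] at h6
      have h7 := (le_abs_self _).trans h6
      rw [mul_sub] at h7
      linarith
    have h8 := mul_le_mul_of_nonneg_left h5 hp0
    have h9 : |v y - k₀| ^ p - p * (k - k₀) * (|v y - k₀| ^ (p - 2) * (v y - k₀))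
        - ε * (1 + 2 * p * B) ≤ |V (R y) - k| ^ p := by
      change -ε ≤ |V (R y) - k₀| ^ p - |v y - k₀| ^ p at h1
      nlinarith
    have h10 := mul_le_mul_of_nonneg_left h9 (hw'.nonneg y)
    simp only
    linarith
  have hfin : (∫ x, w' x * (κ * |v x - k₀| ^ p - ‖fderiv ℝ v x‖ ^ p - δ')) =
      κ * (∫ y, w' y * |v y - k₀| ^ p) - (∫ y, w' y * ‖fderiv ℝ v y‖ ^ p) - δ' * m := by
    have h := hw'.integral_mul_sub_sub hc1 hc2 κ 1 δ'
    simp only [one_mul] at h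
    rw [h]
  rw [hfin] at hg'
  have hεC : ε * C = δ' / 2 := by rw [hε]; field_simp
  have h1 := mul_le_mul_of_nonneg_left hlow hκ.le
  have h2 : κ * (ε * (1 + 2 * p * B) * m) + ε * m = δ' / 2 * m := by
    rw [← hεC, hC]; ring
  have h3 : 0 < δ' * m := by positivity
  linarith

theorem weightedPoincare_euclideanSpace {n : ℕ} (hn : 1 ≤ n) {p κ d : ℝ} (hp : 2 ≤ p)
    (hκ : 0 < κ) (hd : 0 < d)
    (hκd : κ < (2*π*(p-1)^(1/p)/(p*Real.sin (π/p))/d)^p) :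
    WeightedPoincare (EuclideanSpace ℝ (Fin n)) p κ d := by
  induction n, hn using Nat.le_induction with
  | base => exact weightedPoincare_one (weightedPoincare_real hp hκ hd hκd)
  | succ n hn ih => exact ih.succ hn hp hκ

open scoped Convolution in
theorem exists_contDiff_fderiv_dist_le {E : Type*} [NormedAddCommGroup E] [InnerProductSpace ℝ E]
    [FiniteDimensional ℝ E] [MeasurableSpace E] [BorelSpace E] {φ : E → ℝ} (hφ : ContDiff ℝ 1 φ)
    (hs : HasCompactSupport φ) {η : ℝ} (hη : 0 < η) :
    ∃ ψ : E → ℝ, ContDiff ℝ (⊤ : ℕ∞) ψ ∧ HasCompactSupport ψ ∧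
      tsupport ψ ⊆ Metric.cthickening η (tsupport φ) ∧ (∀ x, |ψ x - φ x| ≤ η) ∧
      ∀ x, ‖fderiv ℝ ψ x - fderiv ℝ φ x‖ ≤ η := by
  have hDc : Continuous (fderiv ℝ φ) := hφ.continuous_fderiv one_ne_zero
  obtain ⟨r1, hr1, h1⟩ := Metric.uniformContinuous_iff.1
    (hs.uniformContinuous_of_continuous hφ.continuous) η hη
  obtain ⟨r2, hr2, h2⟩ := Metric.uniformContinuous_iff.1
    ((hs.fderiv ℝ).uniformContinuous_of_continuous hDc) η hη
  set r := min η (min r1 r2) with hr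
  have hr0 : 0 < r := lt_min hη (lt_min hr1 hr2)
  let b : ContDiffBump (0 : E) := ⟨r / 2, r, by linarith, by linarith⟩
  set ψ : E → ℝ := b.normed volume ⋆[ContinuousLinearMap.lsmul ℝ ℝ, volume] φ with hψ
  have hbi : LocallyIntegrable (b.normed volume) (volume : Measure E) :=
    b.continuous_normed.locallyIntegrable
  have hsub : tsupport ψ ⊆ Metric.cthickening η (tsupport φ) := by
    refine closure_minimal ?_ Metric.isClosed_cthickening
    refine (support_convolution_subset _).trans ?_
    rintro _ ⟨y, hy, z, hz, rfl⟩
    rw [b.support_normed_eq] at hy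
    refine Metric.mem_cthickening_of_dist_le _ z _ _ (subset_tsupport _ hz) ?_
    rw [dist_eq_norm, add_sub_cancel_right, ← dist_zero_right]
    exact (Metric.mem_ball.1 hy).le.trans (min_le_left _ _)
  refine ⟨ψ, ?_, ?_, hsub, fun x => ?_, fun x => ?_⟩
  · exact b.hasCompactSupport_normed.contDiff_convolution_left _ b.contDiff_normed
      hφ.continuous.locallyIntegrable
  · exact HasCompactSupport.intro' (hs.isCompact.cthickening (r := η)) Metric.isClosed_cthickening
      fun x hx => by
        by_contra h
        exact hx (hsub (subset_tsupport _ h))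
  · rw [← Real.dist_eq]
    refine b.dist_normed_convolution_le hφ.continuous.aestronglyMeasurable fun y hy => ?_
    exact (h1 ((Metric.mem_ball.1 hy).trans_le ((min_le_right _ _).trans (min_le_left _ _)))).le
  · have hd := hs.hasFDerivAt_convolution_right (μ := volume)
      (ContinuousLinearMap.lsmul ℝ ℝ) hbi hφ x
    have he : (b.normed volume ⋆[(ContinuousLinearMap.lsmul ℝ ℝ).precompR E, volume]
        fderiv ℝ φ) x = (b.normed volume ⋆[ContinuousLinearMap.lsmul ℝ ℝ, volume] fderiv ℝ φ) x := by
      simp only [convolution]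
      refine integral_congr_ae (Eventually.of_forall fun t => ?_)
      ext y
      simp
    rw [hψ, hd.fderiv, he, ← dist_eq_norm]
    refine b.dist_normed_convolution_le hDc.aestronglyMeasurable fun y hy => ?_
    exact (h2 ((Metric.mem_ball.1 hy).trans_le ((min_le_right _ _).trans (min_le_right _ _)))).le

open scoped Topology in
theorem integral_fderiv_apply_eq_of_contDiff_one {E : Type*} [NormedAddCommGroup E]
    [InnerProductSpace ℝ E] [FiniteDimensional ℝ E] [MeasurableSpace E] [BorelSpace E]
    {μ : Measure E} [IsFiniteMeasureOnCompacts μ] {Ω : Set E} (hΩ : IsOpen Ω) {F : E → E}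
    (hF : ContinuousOn F Ω) {g : E → ℝ} (hg : ContinuousOn g Ω) {c : ℝ}
    (h : ∀ φ : E → ℝ, ContDiff ℝ (⊤ : ℕ∞) φ → HasCompactSupport φ → tsupport φ ⊆ Ω →
      ∫ x in Ω, fderiv ℝ φ x (F x) ∂μ = c * ∫ x in Ω, g x * φ x ∂μ)
    {φ : E → ℝ} (hφ : ContDiff ℝ 1 φ) (hs : HasCompactSupport φ) (hsΩ : tsupport φ ⊆ Ω) :
    ∫ x in Ω, fderiv ℝ φ x (F x) ∂μ = c * ∫ x in Ω, g x * φ x ∂μ := by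
  obtain ⟨η, hη, hηΩ⟩ := hs.isCompact.exists_cthickening_subset_open hΩ hsΩ
  set K := Metric.cthickening η (tsupport φ) with hK
  have hKc : IsCompact K := hs.isCompact.cthickening
  obtain ⟨M, hM⟩ := hKc.exists_bound_of_continuousOn (hF.mono hηΩ)
  obtain ⟨N, hN⟩ := hKc.exists_bound_of_continuousOn (hg.mono hηΩ)
  obtain ⟨B, hB⟩ := hφ.continuous.bounded_above_of_compact_support hs
  obtain ⟨D, hD⟩ := (hφ.continuous_fderiv one_ne_zero).bounded_above_of_compact_support
    (hs.fderiv ℝ)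
  have hpos : ∀ k : ℕ, 0 < η / (k + 1) := fun k => by positivity
  have hle : ∀ k : ℕ, η / (k + 1) ≤ η := fun k => div_le_self hη.le (by simp)
  have hlim : Tendsto (fun k : ℕ => η / (k + 1)) atTop (𝓝 0) := by
    simpa [div_eq_mul_inv] using tendsto_one_div_add_atTop_nhds_zero_nat.const_mul η
  choose ψ hψ hψs hψt hψ0 hψ1 using fun k : ℕ =>
    exists_contDiff_fderiv_dist_le hφ hs (hpos k)
  have hψK : ∀ k, tsupport (ψ k) ⊆ K := fun k =>
    (hψt k).trans (Metric.cthickening_mono (hle k) _)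
  have hψz : ∀ k x, x ∉ K → ψ k x = 0 := fun k x hx =>
    image_eq_zero_of_notMem_tsupport fun h => hx (hψK k h)
  have hψz' : ∀ k x, x ∉ K → fderiv ℝ (ψ k) x = 0 := fun k x hx =>
    image_eq_zero_of_notMem_tsupport fun h => hx (hψK k (tsupport_fderiv_subset ℝ h))
  have hint : ∀ R : ℝ, Integrable (K.indicator fun _ => R) (μ.restrict Ω) := fun R =>
    ((integrable_indicator_iff hKc.measurableSet).2
      (integrableOn_const hKc.measure_lt_top.ne)).mono_measure Measure.restrict_le_self
  have t1 : Tendsto (fun k => ∫ x in Ω, fderiv ℝ (ψ k) x (F x) ∂μ) atTop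
      (𝓝 (∫ x in Ω, fderiv ℝ φ x (F x) ∂μ)) := by
    refine tendsto_integral_of_dominated_convergence (K.indicator fun _ => (D + η) * M)
      (fun k => ?_) (hint _) (fun k => Eventually.of_forall fun x => ?_)
      (Eventually.of_forall fun x => ?_)
    · exact (((hψ k).continuous_fderiv (by simp)).continuousOn.clm_apply hF).aestronglyMeasurable
        hΩ.measurableSet
    · by_cases hx : x ∈ K
      · rw [Set.indicator_of_mem hx]
        refine (ContinuousLinearMap.le_opNorm _ _).trans ?_
        have h1 : ‖fderiv ℝ (ψ k) x‖ ≤ D + η := by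
          have := norm_sub_norm_le (fderiv ℝ (ψ k) x) (fderiv ℝ φ x)
          linarith [hψ1 k x, hle k, hD x]
        exact mul_le_mul h1 (hM x hx) (norm_nonneg _) ((norm_nonneg _).trans h1)
      · simp [hψz' k x hx, hx]
    · refine tendsto_iff_norm_sub_tendsto_zero.2 (squeeze_zero (fun _ => norm_nonneg _)
        (fun k => ?_) (by simpa using hlim.mul_const ‖F x‖))
      rw [← sub_apply]
      exact (ContinuousLinearMap.le_opNorm _ _).trans
        (mul_le_mul_of_nonneg_right (hψ1 k x) (norm_nonneg _))
  have t2 : Tendsto (fun k => ∫ x in Ω, g x * ψ k x ∂μ) atTop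
      (𝓝 (∫ x in Ω, g x * φ x ∂μ)) := by
    refine tendsto_integral_of_dominated_convergence (K.indicator fun _ => N * (B + η))
      (fun k => ?_) (hint _) (fun k => Eventually.of_forall fun x => ?_)
      (Eventually.of_forall fun x => ?_)
    · exact (hg.mul (hψ k).continuous.continuousOn).aestronglyMeasurable hΩ.measurableSet
    · by_cases hx : x ∈ K
      · rw [Set.indicator_of_mem hx, norm_mul]
        have h1 : ‖ψ k x‖ ≤ B + η := by
          have := norm_sub_norm_le (ψ k x) (φ x)
          rw [Real.norm_eq_abs (_ - _)] at this
          linarith [hψ0 k x, hle k, hB x]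
        exact mul_le_mul (hN x hx) h1 (norm_nonneg _) ((norm_nonneg _).trans (hN x hx))
      · simp [hψz k x hx, hx]
    · refine Tendsto.const_mul _ (tendsto_iff_norm_sub_tendsto_zero.2
        (squeeze_zero (fun _ => norm_nonneg _) (fun k => hψ0 k x) hlim))
  refine tendsto_nhds_unique t1 ?_
  simp only [fun k => h (ψ k) (hψ k) (hψs k) ((hψK k).trans hηΩ)]
  exact t2.const_mul c

theorem ContDiffOn.contDiff_of_tsupport_subset {E : Type*} [NormedAddCommGroup E]
    [NormedSpace ℝ E] {Ω : Set E} (hΩ : IsOpen Ω)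
    {f : E → ℝ} (hf : ContDiffOn ℝ 1 f Ω) (hs : tsupport f ⊆ Ω) : ContDiff ℝ 1 f := by
  refine contDiff_iff_contDiffAt.2 fun x => ?_
  by_cases hx : x ∈ Ω
  · exact hf.contDiffAt (hΩ.mem_nhds hx)
  · exact (contDiffAt_const (c := (0 : ℝ))).congr_of_eventuallyEq
      (notMem_tsupport_iff_eventuallyEq.1 fun h => hx (hs h))

theorem ContinuousOn.integrableOn_of_eq_zero {E : Type*} [NormedAddCommGroup E]
    [MeasurableSpace E] [BorelSpace E] {μ : Measure E}
    [IsFiniteMeasureOnCompacts μ] {Ω K : Set E} (hK : IsCompact K) (hKΩ : K ⊆ Ω) {f : E → ℝ}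
    (hf : ContinuousOn f Ω) (h0 : ∀ x ∉ K, f x = 0) : IntegrableOn f Ω μ := by
  have : Integrable f μ := by
    rw [← integrableOn_iff_integrable_of_support_subset (s := K)
      fun x hx => by_contra fun h => hx (h0 x h)]
    exact (hf.mono hKΩ).integrableOn_compact hK
  exact this.integrableOn

section Picone

variable {E : Type*} [NormedAddCommGroup E] [InnerProductSpace ℝ E]

theorem norm_gradient_eq_norm_fderiv [CompleteSpace E] (f : E → ℝ) (x : E) : ‖gradient f x‖ = ‖fderiv ℝ f x‖ :=
  LinearIsometryEquiv.norm_map _ _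

theorem inner_gradient_eq_fderiv [CompleteSpace E] (f : E → ℝ) (x y : E) : ⟪y, gradient f x⟫ = fderiv ℝ f x y := by
  rw [real_inner_comm, gradient, InnerProductSpace.toDual_symm_apply]

/-- Picone's identity, pointwise, with the quantitative remainder of `norm_add_rpow_ge`. -/
theorem norm_gradient_rpow_ge [CompleteSpace E] {p : ℝ} (hp : 2 ≤ p) {w v : E → ℝ} {x : E} (hw0 : 0 < w x)
    (hw : DifferentiableAt ℝ w x) (hv : DifferentiableAt ℝ v x) :
    fderiv ℝ (fun y => |v y| ^ p * w y) x (‖gradient w x‖ ^ (p - 2) • gradient w x)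
      + 2 ^ (2 - p) * (w x ^ p * ‖fderiv ℝ v x‖ ^ p) ≤ ‖fderiv ℝ (fun y => v y * w y) x‖ ^ p := by
  have h1 : HasFDerivAt (fun y => |v y| ^ p)
      ((p * |v x| ^ (p - 2) * v x) • fderiv ℝ v x) x :=
    (hasDerivAt_abs_rpow (v x) (by linarith)).comp_hasFDerivAt x hv.hasFDerivAt
  have h2 := h1.mul hw.hasFDerivAt
  have h3 := hv.hasFDerivAt.mul hw.hasFDerivAt
  have h4 : gradient (fun y => v y * w y) x = v x • gradient w x + w x • gradient v x := by
    rw [gradient, show fderiv ℝ (fun y => v y * w y) x = _ from h3.fderiv]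
    simp [gradient]
  rw [← norm_gradient_eq_norm_fderiv, ← norm_gradient_eq_norm_fderiv, h4,
    show fderiv ℝ (fun y => |v y| ^ p * w y) x = _ from h2.fderiv]
  refine le_trans (le_of_eq ?_) (norm_add_rpow_ge hp (v x • gradient w x) (w x • gradient v x))
  simp only [add_apply, smul_apply, smul_eq_mul, map_smul, ← inner_gradient_eq_fderiv,
    norm_smul, Real.norm_eq_abs, real_inner_smul_left, real_inner_smul_right,
    real_inner_self_eq_norm_sq]
  rw [Real.mul_rpow (abs_nonneg _) (norm_nonneg _), Real.mul_rpow (abs_nonneg _) (norm_nonneg _),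
    Real.mul_rpow (abs_nonneg _) (norm_nonneg _), abs_of_pos hw0]
  have h5 : ‖gradient w x‖ ^ p = ‖gradient w x‖ ^ (p - 2) * ‖gradient w x‖ ^ 2 := by
    rw [← Real.rpow_natCast, ← Real.rpow_add_of_nonneg (norm_nonneg _) (by linarith) (by simp)]
    simp
  rw [h5]
  ring

theorem mul_integral_norm_fderiv_le [FiniteDimensional ℝ E] [MeasurableSpace E] [BorelSpace E] {μ : Measure E}
    [IsFiniteMeasureOnCompacts μ] {p l : ℝ} (hp : 2 ≤ p) {Ω : Set E} (hΩ : IsOpen Ω) {w : E → ℝ}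
    (hw : ContDiffOn ℝ 1 w Ω) (hw0 : ∀ x ∈ Ω, 0 < w x)
    (heig : ∀ φ : E → ℝ, ContDiff ℝ (⊤ : ℕ∞) φ → HasCompactSupport φ → tsupport φ ⊆ Ω →
      ∫ x in Ω, ‖gradient w x‖ ^ (p - 2) * ⟪gradient w x, gradient φ x⟫ ∂μ
        = l * ∫ x in Ω, |w x| ^ (p - 2) * w x * φ x ∂μ)
    {v : E → ℝ} (hv : ContDiff ℝ 1 v) (hvs : HasCompactSupport v) (hvΩ : tsupport v ⊆ Ω) :
    2 ^ (2 - p) * (∫ x in Ω, w x ^ p * ‖fderiv ℝ v x‖ ^ p ∂μ) ≤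
      (∫ x in Ω, ‖fderiv ℝ (fun y => v y * w y) x‖ ^ p ∂μ)
        - l * ∫ x in Ω, |v x * w x| ^ p ∂μ := by
  have hp0 : 0 ≤ p := by linarith
  have hG : ContinuousOn (gradient w) Ω :=
    (LinearIsometryEquiv.continuous _).comp_continuousOn
      (hw.continuousOn_fderiv_of_isOpen hΩ le_rfl)
  have hF : ContinuousOn (fun x => ‖gradient w x‖ ^ (p - 2) • gradient w x) Ω :=
    (hG.norm.rpow_const fun x _ => Or.inr (by linarith)).smul hG
  have hwc := hw.continuousOn
  have hg : ContinuousOn (fun x => |w x| ^ (p - 2) * w x) Ω :=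
    (hwc.abs.rpow_const fun x _ => Or.inr (by linarith)).mul hwc
  set φ : E → ℝ := fun y => |v y| ^ p * w y with hφ
  have hφt : tsupport φ ⊆ tsupport v := closure_mono fun x hx h => hx (by
    simp [hφ, h, Real.zero_rpow (by linarith : p ≠ 0)])
  have hφC : ContDiff ℝ 1 φ := ContDiffOn.contDiff_of_tsupport_subset hΩ
    ((ContDiff.norm_rpow hv (by linarith)).contDiffOn.mul hw) (hφt.trans hvΩ)
  have hut : tsupport (fun y => v y * w y) ⊆ tsupport v := tsupport_mul_subset_left
  have huC : ContDiff ℝ 1 (fun y => v y * w y) :=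
    ContDiffOn.contDiff_of_tsupport_subset hΩ (hv.contDiffOn.mul hw) (hut.trans hvΩ)
  have key := integral_fderiv_apply_eq_of_contDiff_one (μ := μ) (c := l) hΩ hF hg
    (fun ψ h1 h2 h3 => by
      rw [← heig ψ h1 h2 h3]
      simp only [map_smul, smul_eq_mul, inner_gradient_eq_fderiv])
    hφC (hvs.mono' (subset_closure.trans hφt)) (hφt.trans hvΩ)
  have e2 : ∫ x in Ω, |w x| ^ (p - 2) * w x * φ x ∂μ = ∫ x in Ω, |v x * w x| ^ p ∂μ := by
    refine setIntegral_congr_fun hΩ.measurableSet fun x hx => ?_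
    have hx0 := hw0 x hx
    simp only [hφ, abs_mul, abs_of_pos hx0]
    rw [Real.mul_rpow (abs_nonneg _) hx0.le, show w x ^ p = w x ^ (p - 2) * w x * w x by
      rw [mul_assoc, ← sq, ← Real.rpow_natCast, ← Real.rpow_add hx0]; simp]
    ring
  rw [← e2, ← key, le_sub_iff_add_le', ← integral_const_mul]
  have hz : ∀ f : E → ℝ, tsupport f ⊆ tsupport v → ∀ x ∉ tsupport v, fderiv ℝ f x = 0 :=
    fun f hf x hx => image_eq_zero_of_notMem_tsupport fun h => hx (hf (tsupport_fderiv_subset ℝ h))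
  have i1 : IntegrableOn (fun x => fderiv ℝ φ x (‖gradient w x‖ ^ (p - 2) • gradient w x)) Ω μ :=
    ContinuousOn.integrableOn_of_eq_zero hvs.isCompact hvΩ
      ((hφC.continuous_fderiv one_ne_zero).continuousOn.clm_apply hF) fun x hx => by
        simp [hz φ hφt x hx]
  have i2 : IntegrableOn (fun x => 2 ^ (2 - p) * (w x ^ p * ‖fderiv ℝ v x‖ ^ p)) Ω μ :=
    ContinuousOn.integrableOn_of_eq_zero hvs.isCompact hvΩ
      (((hwc.rpow_const fun x _ => Or.inr hp0).mul
        ((hv.continuous_fderiv one_ne_zero).norm.rpow_const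
          fun x => Or.inr hp0).continuousOn).const_smul ((2 : ℝ) ^ (2 - p))) fun x hx => by
        simp [hz v le_rfl x hx, Real.zero_rpow (by linarith : p ≠ 0)]
  have i3 : IntegrableOn (fun x => ‖fderiv ℝ (fun y => v y * w y) x‖ ^ p) Ω μ :=
    ContinuousOn.integrableOn_of_eq_zero hvs.isCompact hvΩ
      ((huC.continuous_fderiv one_ne_zero).norm.rpow_const
          fun x => Or.inr hp0).continuousOn fun x hx => by
        simp [hz _ hut x hx, Real.zero_rpow (by linarith : p ≠ 0)]
  rw [← integral_add i1 i2]
  refine setIntegral_mono_on (i1.add i2) i3 hΩ.measurableSet fun x hx => ?_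
  exact norm_gradient_rpow_ge hp (hw0 x hx) ((hw.contDiffAt (hΩ.mem_nhds hx)).differentiableAt
    one_ne_zero) (hv.differentiable one_ne_zero x)

end Picone

instance (n : ℕ) : IsFiniteMeasureOnCompacts (gaussMeasure n) where
  lt_top_of_isCompact K hK := by
    rw [gaussMeasure, withDensity_apply _ hK.measurableSet]
    refine setLIntegral_lt_top_of_isCompact hK.measure_lt_top.ne hK (f := fun x =>
      ((2 * Real.pi) ^ (-(n : ℝ) / 2) * Real.exp (-‖x‖ ^ 2 / 2)).toNNReal) ?_
    exact continuous_real_toNNReal.comp (by fun_prop)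

theorem setIntegral_gaussMeasure {n : ℕ} {s : Set (EuclideanSpace ℝ (Fin n))}
    (hs : MeasurableSet s) (f : EuclideanSpace ℝ (Fin n) → ℝ) :
    ∫ x in s, f x ∂(gaussMeasure n) =
      ∫ x in s, (2 * π) ^ (-(n : ℝ) / 2) * Real.exp (-‖x‖ ^ 2 / 2) * f x := by
  rw [gaussMeasure, setIntegral_withDensity_eq_setIntegral_toReal_smul (by fun_prop)
    (Eventually.of_forall fun x => ENNReal.ofReal_lt_top) _ hs]
  refine integral_congr_ae (Eventually.of_forall fun x => ?_)
  simp only [smul_eq_mul]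
  rw [ENNReal.toReal_ofReal (by positivity)]

theorem isLogConcaveWeight_indicator_gauss {n : ℕ} {p : ℝ} (hp : 0 ≤ p)
    {Ω : Set (EuclideanSpace ℝ (Fin n))} (hΩo : IsOpen Ω) (hΩb : Bornology.IsBounded Ω)
    {f : EuclideanSpace ℝ (Fin n) → ℝ} (hpos : ∀ x ∈ Ω, 0 < f x)
    (hcont : ContinuousOn f (closure Ω)) (hlc : ConcaveOn ℝ Ω fun x => Real.log (f x)) :
    IsLogConcaveWeight (Metric.diam Ω)
      (Ω.indicator fun x => (2 * π) ^ (-(n : ℝ) / 2) * Real.exp (-‖x‖ ^ 2 / 2) * f x ^ p) := by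
  classical
  set c : ℝ := (2 * π) ^ (-(n : ℝ) / 2) with hc
  have hc0 : 0 < c := by positivity
  have hw0 : ∀ x ∈ Ω, 0 < c * Real.exp (-‖x‖ ^ 2 / 2) * f x ^ p := fun x hx => by
    have := hpos x hx
    positivity
  have hnn : ∀ x, 0 ≤ Ω.indicator (fun x => c * Real.exp (-‖x‖ ^ 2 / 2) * f x ^ p) x :=
    Set.indicator_nonneg fun x hx => (hw0 x hx).le
  refine ⟨hnn, ?_, ?_, ?_, ?_⟩
  · rw [← Set.piecewise_eq_indicator]
    refine ContinuousOn.measurable_piecewise ?_ continuousOn_const hΩo.measurableSet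
    refine ContinuousOn.mul (Continuous.continuousOn (by fun_prop)) ?_
    exact (hcont.mono subset_closure).rpow_const fun x _ => Or.inr hp
  · obtain ⟨M, hM⟩ := hΩb.isCompact_closure.exists_bound_of_continuousOn hcont
    refine ⟨max 0 (c * M ^ p), fun x => ?_⟩
    by_cases hx : x ∈ Ω
    · rw [Set.indicator_of_mem hx]
      refine le_max_of_le_right ?_
      have h1 : f x ≤ M := (le_abs_self _).trans (hM x (subset_closure hx))
      have h2 : f x ^ p ≤ M ^ p := Real.rpow_le_rpow (hpos x hx).le h1 hp
      have h3 : Real.exp (-‖x‖ ^ 2 / 2) ≤ 1 := Real.exp_le_one_iff.2 (by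
        have := sq_nonneg ‖x‖
        linarith)
      have h4 : 0 ≤ f x ^ p := Real.rpow_nonneg (hpos x hx).le _
      calc c * Real.exp (-‖x‖ ^ 2 / 2) * f x ^ p ≤ c * 1 * f x ^ p := by gcongr
        _ ≤ c * M ^ p := by rw [mul_one]; gcongr
    · rw [Set.indicator_of_notMem hx]
      exact le_max_left _ _
  · intro x y hx hy
    exact Metric.dist_le_diam_of_mem hΩb (Set.mem_of_indicator_ne_zero hx)
      (Set.mem_of_indicator_ne_zero hy)
  · intro x y s t hs ht hst
    by_cases hx : x ∈ Ω
    swap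
    · rw [Set.indicator_of_notMem hx, Real.zero_rpow hs.ne', zero_mul]
      exact hnn _
    by_cases hy : y ∈ Ω
    swap
    · rw [Set.indicator_of_notMem hy, Real.zero_rpow ht.ne', mul_zero]
      exact hnn _
    have hz : s • x + t • y ∈ Ω := hlc.1 hx hy hs.le ht.le hst
    rw [Set.indicator_of_mem hx, Set.indicator_of_mem hy, Set.indicator_of_mem hz]
    have hlog : ∀ z ∈ Ω, Real.log (c * Real.exp (-‖z‖ ^ 2 / 2) * f z ^ p) =
        Real.log c - ‖z‖ ^ 2 / 2 + p * Real.log (f z) := fun z hz => by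
      have := hpos z hz
      rw [Real.log_mul (by positivity) (by positivity), Real.log_mul hc0.ne' (by positivity),
        Real.log_exp, Real.log_rpow this]
      ring
    rw [Real.rpow_def_of_pos (hw0 x hx), Real.rpow_def_of_pos (hw0 y hy), ← Real.exp_add,
      ← Real.le_log_iff_exp_le (hw0 _ hz), hlog _ hx, hlog _ hy, hlog _ hz]
    have h1 : s * Real.log (f x) + t * Real.log (f y) ≤ Real.log (f (s • x + t • y)) :=
      hlc.2 hx hy hs.le ht.le hst
    have h2 : ‖s • x + t • y‖ ^ 2 ≤ s * ‖x‖ ^ 2 + t * ‖y‖ ^ 2 := by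
      have h3 : ‖s • x + t • y‖ ≤ s * ‖x‖ + t * ‖y‖ := by
        refine (norm_add_le _ _).trans (le_of_eq ?_)
        rw [norm_smul, norm_smul, Real.norm_of_nonneg hs.le, Real.norm_of_nonneg ht.le]
      have h4 := (convexOn_pow (𝕜 := ℝ) 2).2 (norm_nonneg x) (norm_nonneg y) hs.le ht.le hst
      exact (pow_le_pow_left₀ (norm_nonneg _) h3 2).trans h4
    have h5 := mul_le_mul_of_nonneg_left h1 hp
    have h6 : Real.log c = s * Real.log c + t * Real.log c := by rw [← add_mul, hst, one_mul]
    linarith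

theorem mul_iInf_integral_abs_sub_rpow_le {n : ℕ} (hn : 1 ≤ n) {p : ℝ} (hp : 2 ≤ p)
    {Ω : Set (EuclideanSpace ℝ (Fin n))} (hΩo : IsOpen Ω) (hΩb : Bornology.IsBounded Ω)
    {f : EuclideanSpace ℝ (Fin n) → ℝ} (hpos : ∀ x ∈ Ω, 0 < f x)
    (hcont : ContinuousOn f (closure Ω)) (hlc : ConcaveOn ℝ Ω fun x => Real.log (f x))
    {v : EuclideanSpace ℝ (Fin n) → ℝ} (hv : ContDiff ℝ 1 v) (hvs : HasCompactSupport v) :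
    (piP p / Metric.diam Ω) ^ p *
        ⨅ c : ℝ, ∫ x in Ω, |v x * f x - c * f x| ^ p ∂(gaussMeasure n) ≤
      ∫ x in Ω, f x ^ p * ‖fderiv ℝ v x‖ ^ p ∂(gaussMeasure n) := by
  have hp0 : 0 ≤ p := by linarith
  have hw := isLogConcaveWeight_indicator_gauss hp0 hΩo hΩb hpos hcont hlc
  have hconv : ∀ g : EuclideanSpace ℝ (Fin n) → ℝ,
      ∫ x, (Ω.indicator fun x => (2 * π) ^ (-(n : ℝ) / 2) * Real.exp (-‖x‖ ^ 2 / 2) * f x ^ p) x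
        * g x = ∫ x in Ω, f x ^ p * g x ∂(gaussMeasure n) := fun g => by
    rw [setIntegral_gaussMeasure hΩo.measurableSet, ← integral_indicator hΩo.measurableSet]
    refine integral_congr_ae (Eventually.of_forall fun x => ?_)
    by_cases hx : x ∈ Ω
    · simp only [Set.indicator_of_mem hx, mul_assoc]
    · simp only [Set.indicator_of_notMem hx, zero_mul]
  have hshift : ∀ k : ℝ, ∫ x in Ω, f x ^ p * |v x - k| ^ p ∂(gaussMeasure n) =
      ∫ x in Ω, |v x * f x - k * f x| ^ p ∂(gaussMeasure n) := fun k => by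
    refine setIntegral_congr_fun hΩo.measurableSet fun x hx => ?_
    rw [← sub_mul, abs_mul, abs_of_pos (hpos x hx), Real.mul_rpow (abs_nonneg _) (hpos x hx).le,
      mul_comm]
  set I : ℝ := ⨅ c : ℝ, ∫ x in Ω, |v x * f x - c * f x| ^ p ∂(gaussMeasure n) with hI
  set J : ℝ := ∫ x in Ω, f x ^ p * ‖fderiv ℝ v x‖ ^ p ∂(gaussMeasure n) with hJ
  have hI0 : 0 ≤ I := Real.iInf_nonneg fun c => integral_nonneg fun x => by positivity
  have hJ0 : 0 ≤ J := setIntegral_nonneg hΩo.measurableSet fun x hx => by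
    have := hpos x hx
    positivity
  have hbdd : BddBelow (Set.range fun c : ℝ =>
      ∫ x in Ω, |v x * f x - c * f x| ^ p ∂(gaussMeasure n)) :=
    ⟨0, by rintro _ ⟨c, rfl⟩; exact integral_nonneg fun x => by positivity⟩
  by_contra! hlt
  have hI1 : 0 < I := by
    refine lt_of_le_of_ne hI0 fun h => ?_
    rw [← h, mul_zero] at hlt
    linarith
  have hJI : J / I < (piP p / Metric.diam Ω) ^ p := (div_lt_iff₀ hI1).2 hlt
  have hd : 0 < Metric.diam Ω := by
    refine lt_of_le_of_ne Metric.diam_nonneg fun h => ?_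
    rw [← h, div_zero, Real.zero_rpow (by linarith)] at hJI
    exact absurd hJI (not_lt.2 (by positivity))
  obtain ⟨κ, hκ1, hκ2⟩ := exists_between hJI
  have hκ0 : 0 < κ := lt_of_le_of_lt (by positivity) hκ1
  have hfin : κ * I ≤ J := by
    refine le_of_forall_pos_le_add fun δ hδ => ?_
    obtain ⟨k, hk⟩ := weightedPoincare_euclideanSpace hn hp hκ0 hd hκ2 _ hw v hv hvs δ hδ
    rw [hconv, hconv, hshift] at hk
    exact (mul_le_mul_of_nonneg_left (ciInf_le hbdd k) hκ0.le).trans hk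
  exact absurd ((div_lt_iff₀ hI1).1 hκ1) (not_lt.2 hfin)

/-- Stability of the Gaussian `L^p`-Poincaré inequality on bounded convex domains, with the
explicit geometric constant `2^{2-p} (π_p / diam Ω)^p`.  The first Gaussian eigenfunction
`u₁^γ` is positive in `Ω`, `C¹` in `Ω`, continuous up to and vanishing on the boundary, a weak
solution of the Gaussian eigenvalue equation, and `log u₁^γ` is concave (which holds by the
Colesanti–Qin–Salani theorem). -/
theorem stability_gauss_Lp_poincare
    {n : ℕ} (hn : 2 ≤ n) {p : ℝ} (hp : 2 ≤ p)
    {Ω : Set (EuclideanSpace ℝ (Fin n))}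
    (hΩo : IsOpen Ω) (hΩb : Bornology.IsBounded Ω) (hΩc : Convex ℝ Ω)
    (u₁ : EuclideanSpace ℝ (Fin n) → ℝ)
    (hu₁C : ContDiffOn ℝ 1 u₁ Ω)
    (hu₁pos : ∀ x ∈ Ω, 0 < u₁ x)
    (hu₁cont : ContinuousOn u₁ (closure Ω))
    (hu₁bd : ∀ x ∈ frontier Ω, u₁ x = 0)
    (hu₁eig : ∀ φ : EuclideanSpace ℝ (Fin n) → ℝ,
      ContDiff ℝ (⊤ : ℕ∞) φ → HasCompactSupport φ → tsupport φ ⊆ Ω →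
      ∫ x in Ω, ‖gradient u₁ x‖ ^ (p - 2) * ⟪gradient u₁ x, gradient φ x⟫ ∂(gaussMeasure n)
        = lambda1Gauss n p Ω * ∫ x in Ω, |u₁ x| ^ (p - 2) * u₁ x * φ x ∂(gaussMeasure n))
    (hu₁lc : ConcaveOn ℝ Ω fun x => Real.log (u₁ x))
    (u : EuclideanSpace ℝ (Fin n) → ℝ)
    (huC : ContDiff ℝ (⊤ : ℕ∞) u) (huK : HasCompactSupport u) (huS : tsupport u ⊆ Ω) :
    (∫ x in Ω, ‖gradient u x‖ ^ p ∂(gaussMeasure n))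
        - lambda1Gauss n p Ω * ∫ x in Ω, |u x| ^ p ∂(gaussMeasure n)
      ≥ (2 : ℝ) ^ (2 - p) * (piP p / Metric.diam Ω) ^ p *
        ⨅ c : ℝ, ∫ x in Ω, |u x - c * u₁ x| ^ p ∂(gaussMeasure n) := by
  have hvq : ∀ x, u x / u₁ x * u₁ x = u x := fun x => by
    by_cases hx : x ∈ Ω
    · exact div_mul_cancel₀ _ (hu₁pos x hx).ne'
    · simp [image_eq_zero_of_notMem_tsupport fun h => hx (huS h)]
  have hvt : tsupport (fun x => u x / u₁ x) ⊆ tsupport u :=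
    closure_mono fun x hx h => hx (by simp [h])
  have hv : ContDiff ℝ 1 fun x => u x / u₁ x :=
    ContDiffOn.contDiff_of_tsupport_subset hΩo
      ((huC.of_le (by simp)).contDiffOn.div hu₁C fun x hx => (hu₁pos x hx).ne') (hvt.trans huS)
  have hvs : HasCompactSupport fun x => u x / u₁ x := huK.mono' (subset_closure.trans hvt)
  have h1 := mul_integral_norm_fderiv_le hp hΩo hu₁C hu₁pos hu₁eig hv hvs (hvt.trans huS)
  have h2 := mul_iInf_integral_abs_sub_rpow_le (by omega) hp hΩo hΩb hu₁pos hu₁cont hu₁lc hv hvs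
  simp only [hvq] at h1 h2
  simp only [norm_gradient_eq_norm_fderiv]
  rw [ge_iff_le, mul_assoc]
  exact (mul_le_mul_of_nonneg_left h2 (by positivity)).trans h1
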